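/- arXiv:1405.5162 — 3 statements merged into one kernel-verified Lean document; each statement's English description precedes it below -/
import Mathlib

section
/- The pushforward of the Haar probability measure of the unit circle under the map u ↦ u + ū = 2·Re(u) equals the measure on ℝ with density z ↦ 1/(π√(4 − z²)) with respect to the Lebesgue measure restricted to the interval [−2,2]. -/
open MeasureTheory

/-- The image of Lebesgue measure on `ℝ / Tℤ` under `x ↦ exp (2πix / T)` is `T` times the Haar
probability measure of the circle. -/
lemma map_toCircle_volume_eq {T : ℝ} [hT : Fact (0 < T)] [MeasurableSpace Circle]
    [BorelSpace Circle] (μ : Measure Circle) [μ.IsHaarMeasure] [IsProbabilityMeasure μ] :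
    (volume : Measure (AddCircle T)).map AddCircle.toCircle =
      ENNReal.ofReal T • μ := by
  set ν := (volume : Measure (AddCircle T)).map AddCircle.toCircle with hν
  have hm : Measurable (AddCircle.toCircle (T := T)) :=
    AddCircle.continuous_toCircle.measurable
  have hinv : ν.IsMulLeftInvariant := by
    refine ⟨fun g => ?_⟩
    obtain ⟨a, rfl⟩ : ∃ a : AddCircle T, AddCircle.toCircle a = g := by
      obtain ⟨a, ha⟩ := (AddCircle.homeomorphCircle (T := T)
        hT.out.ne').surjective g
      exact ⟨a, by rw [← ha, AddCircle.homeomorphCircle_apply]⟩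
    rw [hν, Measure.map_map (measurable_const_mul _) hm]
    have hcomp : (fun x => AddCircle.toCircle a * x) ∘ AddCircle.toCircle =
        AddCircle.toCircle ∘ fun x => a + x := by
      ext x
      simp [AddCircle.toCircle_add]
    rw [hcomp, ← Measure.map_map hm (measurable_const_add _), map_add_left_eq_self]
  have huniv : ν Set.univ = ENNReal.ofReal T := by
    rw [hν, Measure.map_apply hm MeasurableSet.univ, Set.preimage_univ, AddCircle.measure_univ]
  have hfin : IsFiniteMeasure ν := ⟨by rw [huniv]; exact ENNReal.ofReal_lt_top⟩
  have hsmul := Measure.isMulInvariant_eq_smul_of_compactSpace ν μ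
  have hc : ((Measure.haarScalarFactor ν μ : NNReal) : ENNReal) =
      ENNReal.ofReal T := by
    rw [← huniv, Measure.measure_isMulInvariant_eq_smul_of_isCompact_closure ν μ
      isClosed_closure.isCompact, measure_univ, ENNReal.smul_def, smul_eq_mul, mul_one]
  rw [hsmul, ← hc]
  rfl

lemma lintegral_two_mul_cos_Ioc_neg_pi_pi (f : ℝ → ENNReal) :
    ∫⁻ t in Set.Ioc (-Real.pi) Real.pi, f (2 * Real.cos t) =
      2 * ∫⁻ t in Set.Ioo 0 Real.pi, f (2 * Real.cos t) := by
  have hpi := Real.pi_pos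
  have hneg : ∫⁻ t in Set.Ioo (-Real.pi) 0, f (2 * Real.cos t) =
      ∫⁻ t in Set.Ioo 0 Real.pi, f (2 * Real.cos t) := by
    have h := (Measure.measurePreserving_neg (volume : Measure ℝ)).setLIntegral_comp_preimage_emb
      (MeasurableEquiv.neg ℝ).measurableEmbedding (fun t => f (2 * Real.cos t))
      (Set.Ioo 0 Real.pi)
    simpa [Real.cos_neg] using h
  rw [← Set.Ioc_union_Ioc_eq_Ioc (show -Real.pi ≤ 0 by linarith) hpi.le,
    lintegral_union measurableSet_Ioc (Set.Ioc_disjoint_Ioc_of_le le_rfl),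
    setLIntegral_congr (Ioo_ae_eq_Ioc (a := -Real.pi) (b := 0)).symm,
    setLIntegral_congr (Ioo_ae_eq_Ioc (a := 0) (b := Real.pi)).symm, hneg, two_mul]

lemma image_two_mul_cos_Ioo :
    (fun t => 2 * Real.cos t) '' Set.Ioo 0 Real.pi = Set.Ioo (-2) 2 := by
  ext z
  constructor
  · rintro ⟨t, ht, rfl⟩
    have h := Real.mapsTo_cos_Ioo ht
    exact ⟨by linarith [h.1], by linarith [h.2]⟩
  · rintro ⟨h1, h2⟩
    refine ⟨Real.arccos (z / 2), ⟨Real.arccos_pos.2 (by linarith), ?_⟩, ?_⟩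
    · exact Real.arccos_lt_pi.2 (by linarith)
    · simp only
      rw [Real.cos_arccos (by linarith) (by linarith)]
      ring

lemma lintegral_arcsine_density_mul (f : ℝ → ENNReal) :
    ∫⁻ z in Set.Icc (-2 : ℝ) 2,
        ENNReal.ofReal (1 / (Real.pi * Real.sqrt (4 - z ^ 2))) * f z =
      ENNReal.ofReal (1 / Real.pi) * ∫⁻ t in Set.Ioo 0 Real.pi, f (2 * Real.cos t) := by
  have hanti : AntitoneOn (fun t => 2 * Real.cos t) (Set.Ioo 0 Real.pi) := fun x hx y hy hxy =>
    mul_le_mul_of_nonneg_left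
      (Real.antitoneOn_cos (Set.Ioo_subset_Icc_self hx) (Set.Ioo_subset_Icc_self hy) hxy)
      zero_le_two
  rw [setLIntegral_congr (Ioo_ae_eq_Icc (a := (-2 : ℝ)) (b := 2)).symm, ← image_two_mul_cos_Ioo,
    lintegral_image_eq_lintegral_deriv_mul_of_antitoneOn measurableSet_Ioo
      (fun t _ => ((Real.hasDerivAt_cos t).const_mul 2).hasDerivWithinAt) hanti,
    ← lintegral_const_mul' _ _ ENNReal.ofReal_ne_top]
  refine setLIntegral_congr_fun measurableSet_Ioo fun t ht => ?_
  have hsin : 0 < Real.sin t := Real.sin_pos_of_pos_of_lt_pi ht.1 ht.2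
  have hsqrt : Real.sqrt (4 - (2 * Real.cos t) ^ 2) = 2 * Real.sin t := by
    rw [show 4 - (2 * Real.cos t) ^ 2 = (2 * Real.sin t) ^ 2 by
      linear_combination -4 * Real.sin_sq_add_cos_sq t]
    exact Real.sqrt_sq (by positivity)
  rw [hsqrt, ← mul_assoc, ← ENNReal.ofReal_mul (by linarith)]
  congr 2
  field_simp

/-- The pushforward of the Haar probability measure of the unit circle under the map
`u ↦ u + ū = 2·Re(u)` is the measure on `ℝ` with density `z ↦ 1/(π·√(4 - z²))` with respect
to the Lebesgue measure restricted to `[-2, 2]`. -/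
theorem stmt_3 [MeasurableSpace Circle] [BorelSpace Circle]
    (μ : Measure Circle) [μ.IsHaarMeasure] [IsProbabilityMeasure μ] :
    μ.map (fun u : Circle => 2 * (u : ℂ).re) =
      (volume.restrict (Set.Icc (-2 : ℝ) 2)).withDensity
        (fun z => ENNReal.ofReal (1 / (Real.pi * Real.sqrt (4 - z ^ 2)))) := by
  have hpi := Real.pi_pos
  have : Fact (0 < 2 * Real.pi) := ⟨Real.two_pi_pos⟩
  have hre : Measurable (fun u : Circle => 2 * (u : ℂ).re) :=
    (by fun_prop : Continuous fun u : Circle => 2 * (u : ℂ).re).measurable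
  refine Measure.ext_of_lintegral _ fun f hf => ?_
  rw [lintegral_map hf hre, lintegral_withDensity_eq_lintegral_mul _ (by fun_prop) hf]
  simp only [Pi.mul_apply]
  rw [lintegral_arcsine_density_mul]
  have hcirc : ENNReal.ofReal (2 * Real.pi) * ∫⁻ u, f (2 * (u : ℂ).re) ∂μ =
      2 * ∫⁻ t in Set.Ioo 0 Real.pi, f (2 * Real.cos t) := by
    rw [← lintegral_two_mul_cos_Ioc_neg_pi_pi, ← smul_eq_mul, ← lintegral_smul_measure,
      ← map_toCircle_volume_eq (T := 2 * Real.pi) μ]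
    refine (lintegral_map (hf.comp hre) AddCircle.continuous_toCircle.measurable).trans ?_
    rw [← AddCircle.lintegral_preimage (2 * Real.pi) (-Real.pi),
      show -Real.pi + 2 * Real.pi = Real.pi by ring]
    refine lintegral_congr fun t => ?_
    rw [Function.comp_apply, AddCircle.toCircle_apply_mk, div_self (by positivity), one_mul, Circle.coe_exp,
      Complex.exp_ofReal_mul_I_re]
  have h2 : (2 : ENNReal) = ENNReal.ofReal (2 * Real.pi) * ENNReal.ofReal (1 / Real.pi) := by
    rw [← ENNReal.ofReal_mul (by positivity), mul_assoc, mul_one_div_cancel hpi.ne', mul_one,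
      ENNReal.ofReal_ofNat]
  rw [h2, mul_assoc] at hcirc
  exact (ENNReal.mul_right_inj (by simpa using hpi) ENNReal.ofReal_ne_top).1 hcirc
end

section
/- Let G = SU(2) be the special unitary group of degree 2 (2×2 complex unitary matrices of determinant 1), equipped with its Haar probability measure μ. The pushforward of μ under the trace map A ↦ Re(Tr(A)) equals the semicircular measure on [−2,2], i.e., the measure with density z ↦ (1/(2π))√(4 − z²) with respect to the Lebesgue measure restricted to [−2,2]. -/
open MeasureTheory

/-- `SU(2)`: the set of `2 × 2` complex unitary matrices of determinant `1`. -/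
def SU2 : Set (Matrix (Fin 2) (Fin 2) ℂ) :=
  {A | A ∈ Matrix.unitaryGroup (Fin 2) ℂ ∧ A.det = 1}

open Polynomial

theorem integral_pow_mul_sq_of_rotation_invariant {Ω : Type*} [MeasurableSpace Ω]
    {μ : Measure Ω} {U V : Ω → ℝ}
    (hint : ∀ i j : ℕ, Integrable (fun ω => U ω ^ i * V ω ^ j) μ)
    (hrot : ∀ p q : ℝ, p ^ 2 + q ^ 2 = 1 → ∀ n : ℕ,
      ∫ ω, (p * U ω + q * V ω) ^ n ∂μ = ∫ ω, U ω ^ n ∂μ) (m : ℕ) :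
    (2 * m + 1) * ∫ ω, U ω ^ (2 * m) * V ω ^ 2 ∂μ = ∫ ω, U ω ^ (2 * m + 2) ∂μ := by
  set c := ∫ ω, U ω ^ (2 * m + 2) ∂μ with hc
  set P : ℝ[X] := ∑ j ∈ Finset.range (2 * m + 2 + 1),
    C ((∫ ω, U ω ^ (2 * m + 2 - j) * V ω ^ j ∂μ) * ((2 * m + 2).choose j)) * X ^ j with hP
  set Q : ℝ[X] := C c * expand ℝ 2 ((1 + X) ^ (m + 1)) with hQ
  have hPQ : P = Q := by
    refine Polynomial.funext fun t => ?_
    have h1 : P.eval t = ∫ ω, (U ω + t * V ω) ^ (2 * m + 2) ∂μ := by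
      have : ∀ ω, (U ω + t * V ω) ^ (2 * m + 2) = ∑ j ∈ Finset.range (2 * m + 2 + 1),
          (U ω ^ (2 * m + 2 - j) * V ω ^ j) * (((2 * m + 2).choose j) * t ^ j) := by
        intro ω
        rw [add_comm, add_pow]
        refine Finset.sum_congr rfl fun j _ => ?_
        ring
      simp_rw [this]
      rw [integral_finsetSum _ fun j _ => (hint _ _).mul_const _, hP, eval_finsetSum]
      refine Finset.sum_congr rfl fun j _ => ?_
      rw [integral_mul_const]
      simp [mul_assoc]
    have hpos : 0 < 1 + t ^ 2 := by positivity
    have hr : √(1 + t ^ 2) ^ 2 = 1 + t ^ 2 := Real.sq_sqrt hpos.le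
    have hr0 : √(1 + t ^ 2) ≠ 0 := (Real.sqrt_pos.2 hpos).ne'
    have h2 : ∀ ω, (U ω + t * V ω) ^ (2 * m + 2) = (1 + t ^ 2) ^ (m + 1) *
        (1 / √(1 + t ^ 2) * U ω + t / √(1 + t ^ 2) * V ω) ^ (2 * m + 2) := by
      intro ω
      rw [← hr, ← pow_mul, show 2 * (m + 1) = 2 * m + 2 by ring, ← mul_pow, hr]
      congr 1
      field_simp
    rw [h1]
    simp_rw [h2]
    rw [integral_const_mul, hrot _ _ (by rw [div_pow, div_pow, hr]; field_simp), ← hc, hQ]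
    simp [mul_comm]
  have h := congrArg (fun p : ℝ[X] => p.coeff 2) hPQ
  simp only [hP, hQ, finsetSum_coeff, coeff_C_mul, coeff_X_pow, coeff_expand two_pos] at h
  rw [Finset.sum_eq_single 2 (by intro b _ hb; simp [hb.symm]) (by simp)] at h
  norm_num [coeff_one_add_X_pow, Nat.cast_choose_two] at h
  have hm : (m : ℝ) + 1 ≠ 0 := by positivity
  apply mul_right_cancel₀ hm
  linear_combination h

theorem measure_ext_of_moments {μ ν : Measure ℝ} [IsFiniteMeasure μ] [IsFiniteMeasure ν]
    {a b : ℝ} (hμ : ∀ᵐ x ∂μ, x ∈ Set.Icc a b) (hν : ∀ᵐ x ∂ν, x ∈ Set.Icc a b)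
    (h : ∀ n : ℕ, ∫ x, x ^ n ∂μ = ∫ x, x ^ n ∂ν) : μ = ν := by
  have int {ρ : Measure ℝ} [IsFiniteMeasure ρ] (hρ : ∀ᵐ x ∂ρ, x ∈ Set.Icc a b) {f : ℝ → ℝ}
      (hf : Continuous f) : Integrable f ρ := by
    obtain ⟨K, hK⟩ := isCompact_Icc.exists_bound_of_continuousOn (hf.continuousOn (s := Set.Icc a b))
    exact Integrable.of_bound hf.aestronglyMeasurable K (hρ.mono hK)
  have hpoly (p : ℝ[X]) : ∫ x, p.eval x ∂μ = ∫ x, p.eval x ∂ν := by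
    simp_rw [eval_eq_sum_range]
    rw [integral_finsetSum _ fun j _ => (int hμ (continuous_pow j)).const_mul _,
      integral_finsetSum _ fun j _ => (int hν (continuous_pow j)).const_mul _]
    simp_rw [integral_const_mul, h]
  have hmass : μ.real Set.univ = ν.real Set.univ := by simpa using h 0
  refine ext_of_forall_integral_eq_of_IsFiniteMeasure fun f => ?_
  have close (ε : ℝ) (hε : 0 < ε) :
      |∫ x, f x ∂μ - ∫ x, f x ∂ν| ≤ 2 * μ.real Set.univ * ε := by
    obtain ⟨p, hp⟩ := exists_polynomial_near_of_continuousOn a b f f.continuous.continuousOn ε hε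
    have bd {ρ : Measure ℝ} [IsFiniteMeasure ρ] (hρ : ∀ᵐ x ∂ρ, x ∈ Set.Icc a b) :
        |∫ x, p.eval x ∂ρ - ∫ x, f x ∂ρ| ≤ ε * ρ.real Set.univ := by
      rw [← integral_sub (int hρ p.continuous) (int hρ f.continuous)]
      simpa only [Real.norm_eq_abs] using norm_integral_le_of_norm_le_const (μ := ρ)
        (f := fun x => p.eval x - f x) (hρ.mono fun x hx => (hp x hx).le)
    have h1 := bd hμ
    have h2 := bd hν
    rw [hpoly, abs_le] at h1
    rw [← hmass, abs_le] at h2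
    rw [abs_le]
    constructor <;> linarith
  by_contra hne
  have hpos : 0 < |∫ x, f x ∂μ - ∫ x, f x ∂ν| := abs_pos.2 (sub_ne_zero.2 hne)
  have hM : 0 ≤ μ.real Set.univ := measureReal_nonneg
  set d := |∫ x, f x ∂μ - ∫ x, f x ∂ν|
  have := close (d / (2 * μ.real Set.univ + 1)) (by positivity)
  rw [mul_div_assoc', le_div_iff₀ (by positivity)] at this
  nlinarith

theorem integral_pow_mul_sqrt_recurrence (k : ℕ) :
    (k + 4) * ∫ x in (-2 : ℝ)..2, x ^ (k + 2) * √(4 - x ^ 2) =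
      4 * (k + 1) * ∫ x in (-2 : ℝ)..2, x ^ k * √(4 - x ^ 2) := by
  have hcont (n : ℕ) : Continuous fun x : ℝ => x ^ n * √(4 - x ^ 2) := by fun_prop
  have hd : ∀ x ∈ Set.Ioo (-2 : ℝ) 2,
      HasDerivAt (fun x : ℝ => x ^ (k + 1) * ((4 - x ^ 2) * √(4 - x ^ 2)))
        (4 * (k + 1) * (x ^ k * √(4 - x ^ 2)) - (k + 4) * (x ^ (k + 2) * √(4 - x ^ 2))) x := by
    intro x hx
    have hpos : 0 < 4 - x ^ 2 := by nlinarith [hx.1, hx.2]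
    have h1 : HasDerivAt (fun x : ℝ => 4 - x ^ 2) (-(2 * x)) x := by
      simpa using (hasDerivAt_pow 2 x).const_sub 4
    refine ((hasDerivAt_pow (k + 1) x).mul (h1.mul (h1.sqrt hpos.ne'))).congr_deriv ?_
    have hs : √(4 - x ^ 2) ^ 2 = 4 - x ^ 2 := Real.sq_sqrt hpos.le
    have hs0 : √(4 - x ^ 2) ≠ 0 := (Real.sqrt_pos.2 hpos).ne'
    have hdiv : (4 - x ^ 2) * (-(2 * x) / (2 * √(4 - x ^ 2))) = -x * √(4 - x ^ 2) := by
      field_simp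
      rw [hs]
    simp only [Pi.mul_apply, add_tsub_cancel_right, hdiv]
    push_cast
    ring
  have h := intervalIntegral.integral_eq_sub_of_hasDerivAt_of_le (by norm_num)
    (by fun_prop) hd
    ((((hcont k).const_mul _).sub ((hcont (k + 2)).const_mul _)).intervalIntegrable _ _)
  rw [intervalIntegral.integral_sub ((((hcont k).const_mul _)).intervalIntegrable _ _)
    ((((hcont (k + 2)).const_mul _)).intervalIntegrable _ _),
    intervalIntegral.integral_const_mul, intervalIntegral.integral_const_mul] at h
  norm_num at h
  linarith

theorem integral_sqrt_four_sub_sq : ∫ x in (-2 : ℝ)..2, √(4 - x ^ 2) = 2 * Real.pi := by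
  have h := intervalIntegral.integral_comp_mul_left (a := -1) (b := 1)
    (fun x : ℝ => √(4 - x ^ 2)) (two_ne_zero)
  have h2 : ∀ x : ℝ, √(4 - (2 * x) ^ 2) = 2 * √(1 - x ^ 2) := by
    intro x
    rw [show 4 - (2 * x) ^ 2 = 2 ^ 2 * (1 - x ^ 2) by ring, Real.sqrt_mul (by norm_num),
      Real.sqrt_sq (by norm_num)]
  simp_rw [h2] at h
  rw [intervalIntegral.integral_const_mul, integral_sqrt_one_sub_sq] at h
  norm_num at h
  linarith

theorem integral_mul_sqrt_four_sub_sq : ∫ x in (-2 : ℝ)..2, x * √(4 - x ^ 2) = 0 := by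
  have h := intervalIntegral.integral_comp_neg (a := -2) (b := 2)
    (fun x : ℝ => x * √(4 - x ^ 2))
  simp only [neg_sq, neg_mul, intervalIntegral.integral_neg, neg_neg] at h
  linarith

theorem eq_of_two_step_recurrence {u v : ℕ → ℝ} (h0 : u 0 = v 0) (h1 : u 1 = v 1)
    (hu : ∀ k : ℕ, (k + 4) * u (k + 2) = 4 * (k + 1) * u k)
    (hv : ∀ k : ℕ, (k + 4) * v (k + 2) = 4 * (k + 1) * v k) (n : ℕ) : u n = v n := by
  induction n using Nat.twoStepInduction with
  | zero => exact h0
  | one => exact h1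
  | more k ih _ =>
    have hk : (k : ℝ) + 4 ≠ 0 := by positivity
    exact mul_left_cancel₀ hk (by rw [hu, hv, ih])

theorem SU2.apply_one_one {A : Matrix (Fin 2) (Fin 2) ℂ} (hA : A ∈ SU2) :
    A 1 1 = star (A 0 0) := by
  obtain ⟨hU, hdet⟩ := hA
  have h1 : A * star A = 1 := Matrix.mem_unitaryGroup_iff.1 hU
  have h2 : A.adjugate * A = 1 := by rw [Matrix.adjugate_mul, hdet, one_smul]
  have h3 : A.adjugate = star A := left_inv_eq_right_inv h2 h1
  simpa [Matrix.adjugate_fin_two, Matrix.star_apply] using congrFun (congrFun h3 0) 0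

theorem SU2.sum_sq_eq_one {A : Matrix (Fin 2) (Fin 2) ℂ} (hA : A ∈ SU2) :
    (A 0 0).re ^ 2 + (A 0 0).im ^ 2 + (A 1 0).re ^ 2 + (A 1 0).im ^ 2 = 1 := by
  have h1 : star A * A = 1 := Matrix.mem_unitaryGroup_iff'.1 hA.1
  have h := congrArg Complex.re (congrFun (congrFun h1 0) 0)
  simp [Matrix.mul_apply, Fin.sum_univ_two] at h
  linarith

theorem SU2.trace_re {A : Matrix (Fin 2) (Fin 2) ℂ} (hA : A ∈ SU2) :
    A.trace.re = 2 * (A 0 0).re := by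
  rw [Matrix.trace_fin_two, SU2.apply_one_one hA]
  simp [two_mul]

/-- Every unit vector of `ℝ⁴` is realized as a row of coefficients of left multiplication by an
element of `SU(2)`, acting on the real coordinates of the first column. -/
theorem SU2.exists_mul_re_eq {p q r s : ℝ} (h : p ^ 2 + q ^ 2 + r ^ 2 + s ^ 2 = 1) :
    ∃ B ∈ SU2, ∀ A : Matrix (Fin 2) (Fin 2) ℂ, ((B * A) 0 0).re =
      p * (A 0 0).re + q * (A 0 0).im + r * (A 1 0).re + s * (A 1 0).im := by
  refine ⟨!![⟨p, -q⟩, ⟨r, -s⟩; ⟨-r, -s⟩, ⟨p, q⟩], ⟨Matrix.mem_unitaryGroup_iff.2 ?_, ?_⟩, ?_⟩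
  · ext i j
    fin_cases i <;> fin_cases j <;>
      simp [Matrix.mul_apply, Fin.sum_univ_two, Complex.ext_iff] <;>
      constructor <;> linarith
  · simp [Matrix.det_fin_two, Complex.ext_iff]
    constructor <;> linarith
  · intro A
    simp [Matrix.mul_apply, Fin.sum_univ_two]
    ring

theorem SU2.ae_mem [MeasurableSpace (Matrix (Fin 2) (Fin 2) ℂ)]
    {μ : Measure (Matrix (Fin 2) (Fin 2) ℂ)} (hcarrier : μ SU2ᶜ = 0) : ∀ᵐ A ∂μ, A ∈ SU2 :=
  hcarrier

theorem SU2.integral_trace_re_pow [MeasurableSpace (Matrix (Fin 2) (Fin 2) ℂ)]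
    {μ : Measure (Matrix (Fin 2) (Fin 2) ℂ)} (hcarrier : μ SU2ᶜ = 0) (n : ℕ) :
    ∫ A, A.trace.re ^ n ∂μ = 2 ^ n * ∫ A, (A 0 0).re ^ n ∂μ := by
  rw [← integral_const_mul]
  refine integral_congr_ae ((SU2.ae_mem hcarrier).mono fun A hA => ?_)
  simp only [SU2.trace_re hA, mul_pow]

section HaarMoments

variable [MeasurableSpace (Matrix (Fin 2) (Fin 2) ℂ)] [BorelSpace (Matrix (Fin 2) (Fin 2) ℂ)]
  {μ : Measure (Matrix (Fin 2) (Fin 2) ℂ)}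

theorem SU2.integral_linear_pow (hinv : ∀ B ∈ SU2, μ.map (fun A => B * A) = μ) {p q r s : ℝ}
    (h : p ^ 2 + q ^ 2 + r ^ 2 + s ^ 2 = 1) (n : ℕ) :
    ∫ A, (p * (A 0 0).re + q * (A 0 0).im + r * (A 1 0).re + s * (A 1 0).im) ^ n ∂μ =
      ∫ A, (A 0 0).re ^ n ∂μ := by
  obtain ⟨B, hB, hBA⟩ := SU2.exists_mul_re_eq h
  have hm : Measurable fun A : Matrix (Fin 2) (Fin 2) ℂ => B * A :=
    (continuous_const.mul continuous_id).measurable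
  have hc : Continuous fun A : Matrix (Fin 2) (Fin 2) ℂ => (A 0 0).re ^ n := by fun_prop
  conv_rhs => rw [← hinv B hB, integral_map hm.aemeasurable hc.measurable.aestronglyMeasurable]
  simp_rw [hBA]

theorem SU2.integral_re_pow_recurrence [IsProbabilityMeasure μ] (hcarrier : μ SU2ᶜ = 0)
    (hinv : ∀ B ∈ SU2, μ.map (fun A => B * A) = μ) (m : ℕ) :
    (2 * m + 4) * ∫ A, (A 0 0).re ^ (2 * m + 2) ∂μ =
      (2 * m + 1) * ∫ A, (A 0 0).re ^ (2 * m) ∂μ := by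
  have hint {g : Matrix (Fin 2) (Fin 2) ℂ → ℝ} (hg : Continuous g)
      (hg1 : ∀ A ∈ SU2, g A ^ 2 ≤ 1) (i j : ℕ) :
      Integrable (fun A : Matrix (Fin 2) (Fin 2) ℂ => (A 0 0).re ^ i * g A ^ j) μ := by
    have hc : Continuous fun A : Matrix (Fin 2) (Fin 2) ℂ => (A 0 0).re ^ i * g A ^ j := by
      fun_prop
    refine Integrable.of_bound hc.measurable.aestronglyMeasurable 1
      ((SU2.ae_mem hcarrier).mono fun A hA => ?_)
    have h1 : |(A 0 0).re| ≤ 1 := by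
      rw [← sq_le_one_iff_abs_le_one]
      nlinarith [SU2.sum_sq_eq_one hA]
    have h2 : |g A| ≤ 1 := (sq_le_one_iff_abs_le_one _).1 (hg1 A hA)
    rw [Real.norm_eq_abs, abs_mul, abs_pow, abs_pow]
    exact mul_le_one₀ (pow_le_one₀ (abs_nonneg _) h1) (by positivity)
      (pow_le_one₀ (abs_nonneg _) h2)
  have i2 := hint (g := fun A => (A 0 0).im) (by fun_prop)
    (fun A hA => by nlinarith [SU2.sum_sq_eq_one hA])
  have i3 := hint (g := fun A => (A 1 0).re) (by fun_prop)
    (fun A hA => by nlinarith [SU2.sum_sq_eq_one hA])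
  have i4 := hint (g := fun A => (A 1 0).im) (by fun_prop)
    (fun A hA => by nlinarith [SU2.sum_sq_eq_one hA])
  have h2 := integral_pow_mul_sq_of_rotation_invariant i2 (fun p q hpq n => by
    simpa using SU2.integral_linear_pow hinv (p := p) (q := q) (r := 0) (s := 0) (by simpa) n) m
  have h3 := integral_pow_mul_sq_of_rotation_invariant i3 (fun p q hpq n => by
    simpa using SU2.integral_linear_pow hinv (p := p) (q := 0) (r := q) (s := 0) (by simpa) n) m
  have h4 := integral_pow_mul_sq_of_rotation_invariant i4 (fun p q hpq n => by
    simpa using SU2.integral_linear_pow hinv (p := p) (q := 0) (r := 0) (s := q) (by simpa) n) m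
  have hsum : ∫ A, (A 0 0).re ^ (2 * m) ∂μ = ∫ A, (A 0 0).re ^ (2 * m + 2) ∂μ +
      ∫ A, (A 0 0).re ^ (2 * m) * (A 0 0).im ^ 2 ∂μ +
      ∫ A, (A 0 0).re ^ (2 * m) * (A 1 0).re ^ 2 ∂μ +
      ∫ A, (A 0 0).re ^ (2 * m) * (A 1 0).im ^ 2 ∂μ := by
    have i1 : Integrable (fun A : Matrix (Fin 2) (Fin 2) ℂ => (A 0 0).re ^ (2 * m + 2)) μ := by
      simpa using i2 (2 * m + 2) 0
    have i12 : Integrable (fun A : Matrix (Fin 2) (Fin 2) ℂ => (A 0 0).re ^ (2 * m + 2) +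
        (A 0 0).re ^ (2 * m) * (A 0 0).im ^ 2) μ := i1.add (i2 (2 * m) 2)
    have i123 : Integrable (fun A : Matrix (Fin 2) (Fin 2) ℂ => (A 0 0).re ^ (2 * m + 2) +
        (A 0 0).re ^ (2 * m) * (A 0 0).im ^ 2 + (A 0 0).re ^ (2 * m) * (A 1 0).re ^ 2) μ :=
      i12.add (i3 (2 * m) 2)
    rw [← integral_add i1 (i2 _ _), ← integral_add i12 (i3 _ _), ← integral_add i123 (i4 _ _)]
    refine integral_congr_ae ((SU2.ae_mem hcarrier).mono fun A hA => ?_)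
    dsimp only
    linear_combination -(A 0 0).re ^ (2 * m) * SU2.sum_sq_eq_one hA
  linear_combination -(2 * m + 1 : ℝ) * hsum - h2 - h3 - h4

theorem SU2.integral_re_pow_odd (hinv : ∀ B ∈ SU2, μ.map (fun A => B * A) = μ) (m : ℕ) :
    ∫ A, (A 0 0).re ^ (2 * m + 1) ∂μ = 0 := by
  have h := SU2.integral_linear_pow hinv (p := -1) (q := 0) (r := 0) (s := 0) (by norm_num)
    (2 * m + 1)
  simp only [neg_mul, one_mul, zero_mul, add_zero, (odd_two_mul_add_one m).neg_pow,
    integral_neg] at h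
  linarith

theorem SU2.integral_trace_re_pow_recurrence [IsProbabilityMeasure μ] (hcarrier : μ SU2ᶜ = 0)
    (hinv : ∀ B ∈ SU2, μ.map (fun A => B * A) = μ) (k : ℕ) :
    (k + 4) * ∫ A, A.trace.re ^ (k + 2) ∂μ = 4 * (k + 1) * ∫ A, A.trace.re ^ k ∂μ := by
  simp_rw [SU2.integral_trace_re_pow hcarrier]
  obtain ⟨m, rfl | rfl⟩ := k.even_or_odd'
  · push_cast
    linear_combination 4 * 2 ^ (2 * m) * SU2.integral_re_pow_recurrence hcarrier hinv m
  · rw [show 2 * m + 1 + 2 = 2 * (m + 1) + 1 by ring, SU2.integral_re_pow_odd hinv,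
      SU2.integral_re_pow_odd hinv]
    simp

end HaarMoments

/-- The moments of the semicircular measure on `[-2, 2]`. -/
theorem integral_pow_semicircle (n : ℕ) :
    ∫ x, x ^ n ∂(volume.restrict (Set.Icc (-2 : ℝ) 2)).withDensity
        (fun z => ENNReal.ofReal (√(4 - z ^ 2) / (2 * Real.pi))) =
      (∫ x in (-2 : ℝ)..2, x ^ n * √(4 - x ^ 2)) / (2 * Real.pi) := by
  rw [integral_withDensity_eq_integral_toReal_smul (by fun_prop) (by simp),
    intervalIntegral.integral_of_le (by norm_num), ← integral_Icc_eq_integral_Ioc,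
    ← integral_div]
  refine integral_congr_ae (ae_of_all _ fun x => ?_)
  simp only [smul_eq_mul]
  rw [ENNReal.toReal_ofReal (by positivity)]
  ring

/-- The pushforward of the Haar probability measure of `SU(2)` under `A ↦ Re(Tr A)` is the
semicircular measure on `[-2, 2]`, i.e. the measure with density `z ↦ (1/(2π))·√(4 - z²)`
with respect to the Lebesgue measure restricted to `[-2, 2]`.  The Haar probability measure
of the compact group `SU(2)` is formalized as a Borel probability measure on the space of
`2 × 2` complex matrices, carried by `SU(2)`, which is invariant under left translation by
every element of `SU(2)`; these properties characterize it uniquely. -/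
theorem stmt_4 [MeasurableSpace (Matrix (Fin 2) (Fin 2) ℂ)]
    [BorelSpace (Matrix (Fin 2) (Fin 2) ℂ)]
    (μ : Measure (Matrix (Fin 2) (Fin 2) ℂ)) [IsProbabilityMeasure μ]
    (hcarrier : μ SU2ᶜ = 0)
    (hinv : ∀ B ∈ SU2, μ.map (fun A => B * A) = μ) :
    μ.map (fun A : Matrix (Fin 2) (Fin 2) ℂ => A.trace.re) =
      (volume.restrict (Set.Icc (-2 : ℝ) 2)).withDensity
        (fun z => ENNReal.ofReal (Real.sqrt (4 - z ^ 2) / (2 * Real.pi))) := by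
  have htr : Continuous fun A : Matrix (Fin 2) (Fin 2) ℂ => A.trace.re := by fun_prop
  have : IsProbabilityMeasure (μ.map fun A : Matrix (Fin 2) (Fin 2) ℂ => A.trace.re) :=
    Measure.isProbabilityMeasure_map htr.measurable.aemeasurable
  have : IsFiniteMeasure ((volume.restrict (Set.Icc (-2 : ℝ) 2)).withDensity
      (fun z => ENNReal.ofReal (Real.sqrt (4 - z ^ 2) / (2 * Real.pi)))) := by
    have hc : Continuous fun z : ℝ => √(4 - z ^ 2) / (2 * Real.pi) := by fun_prop
    exact isFiniteMeasure_withDensity_ofReal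
      (hc.continuousOn.integrableOn_compact isCompact_Icc).2
  refine measure_ext_of_moments (a := -2) (b := 2) ?_ ?_ ?_
  · refine (ae_map_iff htr.measurable.aemeasurable measurableSet_Icc).2 <|
      (SU2.ae_mem hcarrier).mono fun A hA => ?_
    rw [SU2.trace_re hA]
    have := SU2.sum_sq_eq_one hA
    constructor <;> nlinarith
  · exact (withDensity_absolutelyContinuous _ _).ae_le (ae_restrict_mem measurableSet_Icc)
  · have hmap (n : ℕ) : ∫ x, x ^ n ∂(μ.map fun A : Matrix (Fin 2) (Fin 2) ℂ => A.trace.re) =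
        ∫ A, A.trace.re ^ n ∂μ :=
      integral_map htr.measurable.aemeasurable (continuous_pow n).aestronglyMeasurable
    simp_rw [hmap, integral_pow_semicircle]
    refine eq_of_two_step_recurrence ?_ ?_
      (SU2.integral_trace_re_pow_recurrence hcarrier hinv) fun k => ?_
    · simp [integral_sqrt_four_sub_sq, Real.pi_ne_zero]
    · have h := SU2.integral_re_pow_odd hinv 0
      rw [SU2.integral_trace_re_pow hcarrier]
      simp only [mul_zero, zero_add, pow_one] at h
      simp only [pow_one, integral_mul_sqrt_four_sub_sq, h, mul_zero, zero_div]
    · linear_combination integral_pow_mul_sqrt_recurrence k / (2 * Real.pi)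
end

section
/- Let K be an imaginary quadratic field with a fixed embedding K ↪ ℂ, 𝔑 a nonzero ideal of O_K, and l ≥ 1 an integer. Let ψ be an algebraic Hecke character of K modulo 𝔑 of infinity type l: a multiplicative function from the nonzero ideals of O_K coprime to 𝔑 to ℂ* satisfying ψ(αO_K) = α^l for every α ∈ O_K with α ≡ 1 (mod 𝔑). Then the Euler product ∏_{𝔭∤𝔑} (1 − ψ(𝔭)·N(𝔭)^{−l/2}·N(𝔭)^{−s})^{−1}, which converges for Re(s) > 1, extends to a holomorphic function on an open neighborhood of the closed half-plane {Re(s) ≥ 1} that is nonvanishing on {Re(s) ≥ 1}. -/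
open NumberField

section EulerProduct

variable {R : Type*} [CommRing R] [IsDedekindDomain R]

open scoped Classical in
/-- Sieving out finitely many primes from the sum of a completely multiplicative function. -/
theorem tsum_ideal_not_dvd (f : Ideal R →*₀ ℂ) (hf : Summable fun I ↦ ‖f I‖)
    (S : Finset (Ideal R)) (hS : ∀ p ∈ S, Prime p) :
    ∑' I, (if ∀ p ∈ S, ¬ p ∣ I then f I else 0) = (∏ p ∈ S, (1 - f p)) * ∑' I, f I := by
  induction S using Finset.induction_on with
  | empty => simp
  | insert q S hq ih =>
    have hqp : Prime q := hS q (Finset.mem_insert_self _ _)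
    have hSp : ∀ p ∈ S, Prime p := fun p hp ↦ hS p (Finset.mem_insert_of_mem hp)
    rw [Finset.prod_insert hq, mul_assoc, ← ih hSp]
    set g : Ideal R → ℂ := fun I ↦ if ∀ p ∈ S, ¬ p ∣ I then f I else 0 with hg
    have hgs : Summable g := by
      refine Summable.of_norm_bounded hf fun I ↦ ?_
      simp only [hg]; split_ifs <;> simp
    have hmulq (I : Ideal R) : g (q * I) = f q * g I := by
      have : (∀ p ∈ S, ¬ p ∣ q * I) ↔ ∀ p ∈ S, ¬ p ∣ I := by
        refine forall₂_congr fun p hp ↦ not_congr ⟨fun h ↦ ?_, fun h ↦ h.mul_left q⟩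
        refine ((hSp p hp).dvd_or_dvd h).resolve_left fun h' ↦ hq ?_
        rwa [← associated_iff_eq.mp ((hSp p hp).associated_of_dvd hqp h')]
      simp only [hg, this, map_mul]
      split_ifs <;> simp
    have hinj : Function.Injective fun I : Ideal R ↦ q * I := mul_right_injective₀ hqp.ne_zero
    have hsplit : ∀ I, (if ∀ p ∈ insert q S, ¬ p ∣ I then f I else 0)
        = g I - (Set.range fun I : Ideal R ↦ q * I).indicator g I := by
      intro I
      by_cases h : q ∣ I
      · have : I ∈ Set.range fun I : Ideal R ↦ q * I := by
          obtain ⟨J, rfl⟩ := h; exact ⟨J, rfl⟩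
        rw [Set.indicator_of_mem this, sub_self, if_neg]
        exact fun h' ↦ h' q (Finset.mem_insert_self _ _) h
      · have : I ∉ Set.range fun I : Ideal R ↦ q * I := by
          rintro ⟨J, rfl⟩; exact h ⟨J, rfl⟩
        rw [Set.indicator_of_notMem this, sub_zero]
        simp [hg, h]
    rw [tsum_congr hsplit, hgs.tsum_sub (hgs.indicator _), ← tsum_subtype, tsum_range g hinj,
      tsum_congr hmulq, tsum_mul_left]
    ring

/-- The Euler product of a completely multiplicative summable function on ideals. -/
theorem hasProd_ideal_of_summable (f : Ideal R →*₀ ℂ) (hf : Summable fun I ↦ ‖f I‖)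
    (P : Ideal R → Prop) (hP : ∀ p, P p → Prime p) (hfP : ∀ p, Prime p → ¬ P p → f p = 0) :
    HasProd (fun p : {p // P p} ↦ (1 - f p)⁻¹) (∑' I, f I) := by
  classical
  have key : Filter.Tendsto (fun S : Finset {p // P p} ↦ (∏ p ∈ S, (1 - f p)) * ∑' I, f I)
      Filter.atTop (nhds 1) := by
    have h1 : ∑' I : Ideal R, (if I = 1 then (1 : ℂ) else 0) = 1 := tsum_ite_eq 1 _
    have := tendsto_tsum_of_dominated_convergence (𝓕 := Filter.atTop)
      (f := fun (S : Finset {p // P p}) (I : Ideal R) ↦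
        if ∀ p ∈ S.map (Function.Embedding.subtype P), ¬ p ∣ I then f I else 0)
      (g := fun I ↦ if I = 1 then (1 : ℂ) else 0) hf ?_ ?_
    · rw [h1] at this
      refine this.congr fun S ↦ ?_
      rw [tsum_ideal_not_dvd f hf _ (by simpa using fun p hp _ ↦ hP p hp), Finset.prod_map]
      rfl
    · intro I
      apply tendsto_const_nhds.congr'
      by_cases hI : I = 1
      · subst hI
        refine Filter.Eventually.of_forall fun S ↦ ?_
        beta_reduce
        rw [if_pos rfl, if_pos, map_one]
        intro p hp hd
        simp only [Finset.mem_map, Function.Embedding.subtype_apply] at hp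
        obtain ⟨p, -, rfl⟩ := hp
        exact (hP p p.2).not_isUnit (isUnit_of_dvd_one hd)
      by_cases hI0 : I = 0
      · refine Filter.Eventually.of_forall fun S ↦ ?_
        beta_reduce
        rw [if_neg hI, hI0, map_zero, ite_self]
      obtain ⟨p, hp, hd⟩ := WfDvdMonoid.exists_irreducible_factor
        (fun h ↦ hI (by simpa using h)) hI0
      have hp := UniqueFactorizationMonoid.irreducible_iff_prime.mp hp
      by_cases hPp : P p
      · filter_upwards [Filter.eventually_ge_atTop {⟨p, hPp⟩}] with S hS
        rw [if_neg hI, if_neg]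
        intro h
        refine h p ?_ hd
        simp only [Finset.singleton_subset_iff] at hS
        simpa using ⟨hPp, hS⟩
      · obtain ⟨J, rfl⟩ := hd
        refine Filter.Eventually.of_forall fun S ↦ ?_
        simp only [if_neg hI, map_mul, hfP p hp hPp, zero_mul, ite_self]
    · refine Filter.Eventually.of_forall fun S I ↦ ?_
      split_ifs <;> simp
  have hne : ∑' I, f I ≠ 0 := by
    intro h
    simp only [h, mul_zero] at key
    exact zero_ne_one (tendsto_nhds_unique tendsto_const_nhds key)
  rw [HasProd, SummationFilter.unconditional_filter]
  have h2 := (key.mul_const (∑' I, f I)⁻¹).inv₀ (by simpa using hne)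
  simp only [one_mul, inv_inv] at h2
  refine h2.congr fun S ↦ ?_
  rw [mul_assoc, mul_inv_cancel₀ hne, mul_one, Finset.prod_inv_distrib]

/-- The `3-4-1` inequality for a single Euler factor. -/
theorem one_le_norm_euler_factor {a : ℝ} (ha₀ : 0 ≤ a) (ha₁ : a < 1) {z : ℂ} (hz : ‖z‖ = 1) :
    1 ≤ ‖(1 - (a : ℂ))⁻¹‖ ^ 3 * ‖(1 - a * z)⁻¹‖ ^ 4 * ‖(1 - a * z ^ 2)⁻¹‖ := by
  have hac₀ : ‖(a : ℂ)‖ < 1 := by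
    simp only [Complex.norm_of_nonneg ha₀, ha₁]
  have hac₁ : ‖a * z‖ < 1 := by rwa [norm_mul, hz, mul_one]
  have hac₂ : ‖a * z ^ 2‖ < 1 := by rwa [norm_mul, norm_pow, hz, one_pow, mul_one]
  have hlog : 0 ≤ 3 * (-Complex.log (1 - a)).re + 4 * (-Complex.log (1 - a * z)).re
      + (-Complex.log (1 - a * z ^ 2)).re := by
    rw [← ((Complex.hasSum_re <| Complex.hasSum_taylorSeries_neg_log hac₀).mul_left 3).add
      ((Complex.hasSum_re <| Complex.hasSum_taylorSeries_neg_log hac₁).mul_left 4) |>.add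
      (Complex.hasSum_re <| Complex.hasSum_taylorSeries_neg_log hac₂) |>.tsum_eq]
    refine tsum_nonneg fun n ↦ ?_
    simp only [← Complex.ofReal_pow, Complex.div_natCast_re, Complex.ofReal_re, mul_pow,
      Complex.re_ofReal_mul]
    rw [← pow_mul, pow_mul', mul_div_assoc', mul_div_assoc', ← add_div, ← add_div]
    refine div_nonneg ?_ n.cast_nonneg
    rw [show 3 * a ^ n + 4 * (a ^ n * (z ^ n).re) + a ^ n * ((z ^ n) ^ 2).re
      = a ^ n * (3 + 4 * (z ^ n).re + ((z ^ n) ^ 2).re) by ring]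
    refine mul_nonneg (pow_nonneg ha₀ n) ?_
    have h1 : ‖z ^ n‖ ^ 2 = 1 := by rw [norm_pow, hz, one_pow, one_pow]
    rw [← Complex.normSq_eq_norm_sq, Complex.normSq_apply] at h1
    rw [sq (z ^ n), Complex.mul_re]
    nlinarith [sq_nonneg ((z ^ n).re + 1)]
  have hfac {w : ℂ} (hw : ‖w‖ < 1) : ‖(1 - w)⁻¹‖ = Real.exp ((-Complex.log (1 - w)).re) := by
    have : 1 - w ≠ 0 := by
      rintro h; rw [← sub_eq_zero.mp h, norm_one] at hw; exact lt_irrefl _ hw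
    rw [Complex.neg_re, Complex.log_re, Real.exp_neg, Real.exp_log (norm_pos_iff.mpr this),
      norm_inv]
  rw [hfac hac₀, hfac hac₁, hfac hac₂, ← Real.exp_nat_mul, ← Real.exp_nat_mul, ← Real.exp_add,
    ← Real.exp_add]
  exact Real.one_le_exp (by exact_mod_cast hlog)

theorem one_le_norm_tsum_mul (f₀ f₁ f₂ : Ideal R →*₀ ℂ) (h₀ : Summable fun I ↦ ‖f₀ I‖)
    (h₁ : Summable fun I ↦ ‖f₁ I‖) (h₂ : Summable fun I ↦ ‖f₂ I‖)
    (h : ∀ p, Prime p → ∃ (a : ℝ) (z : ℂ), 0 ≤ a ∧ a < 1 ∧ ‖z‖ = 1 ∧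
      f₀ p = a ∧ f₁ p = a * z ∧ f₂ p = a * z ^ 2) :
    1 ≤ ‖∑' I, f₀ I‖ ^ 3 * ‖∑' I, f₁ I‖ ^ 4 * ‖∑' I, f₂ I‖ := by
  have hp (f : Ideal R →*₀ ℂ) (hf : Summable fun I ↦ ‖f I‖) :
      HasProd (fun p : {p : Ideal R // Prime p} ↦ ‖(1 - f p)⁻¹‖) ‖∑' I, f I‖ :=
    (hasProd_ideal_of_summable f hf Prime (fun _ h ↦ h) fun p hp hp' ↦ absurd hp hp').map
      (normHom : ℂ →*₀ ℝ) continuous_norm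
  have := (((hp f₀ h₀).pow 3).mul ((hp f₁ h₁).pow 4)).mul (hp f₂ h₂)
  refine ge_of_tendsto this (Filter.Eventually.of_forall fun S ↦ ?_)
  rw [← Finset.prod_const_one (s := S)]
  refine Finset.prod_le_prod (fun _ _ ↦ zero_le_one) fun p _ ↦ ?_
  obtain ⟨a, z, ha₀, ha₁, hz, e₀, e₁, e₂⟩ := h p p.2
  rw [e₀, e₁, e₂]
  exact one_le_norm_euler_factor ha₀ ha₁ hz

end EulerProduct

section IdealSums
open Filter Topology

variable (K : Type*) [Field K] [NumberField K]

theorem hasSum_absNorm_rpow_dedekindZeta {σ : ℝ} (hσ : 1 < σ) :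
    HasSum (fun I : Ideal (𝓞 K) ↦ (Ideal.absNorm I : ℝ) ^ (-σ)) ‖dedekindZeta K σ‖ := by
  set a : ℕ → ℕ := fun n ↦ Nat.card {I : Ideal (𝓞 K) // Ideal.absNorm I = n} with ha
  have hsum : LSeriesSummable (fun n ↦ (a n : ℂ)) σ := by
    have h1 := (tendsto_sub_one_mul_dedekindZeta_nhdsGT K).eventually_ne
      (Complex.ofReal_ne_zero.mpr (dedekindZeta_residue_ne_zero K))
    obtain ⟨τ, hτ, hτ1⟩ := (h1.and (Ioo_mem_nhdsGT hσ)).exists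
    have : LSeriesSummable (fun n ↦ (a n : ℂ)) τ := by
      by_contra h
      exact hτ (by rw [dedekindZeta, LSeries, tsum_eq_zero_of_not_summable h, mul_zero])
    exact this.of_re_le_re (by simpa using hτ1.2.le)
  have hterm (n : ℕ) : LSeries.term (fun n ↦ (a n : ℂ)) σ n
      = ((a n * (n : ℝ) ^ (-σ) : ℝ) : ℂ) := by
    rcases eq_or_ne n 0 with rfl | hn
    · simp [Real.zero_rpow (by linarith : -σ ≠ 0)]
    · rw [LSeries.term_of_ne_zero hn, Complex.ofReal_mul, Complex.ofReal_cpow (Nat.cast_nonneg _),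
        Complex.ofReal_neg, Complex.cpow_neg, div_eq_mul_inv, Complex.ofReal_natCast,
        Complex.ofReal_natCast]
  have hsumR : Summable fun n : ℕ ↦ (a n * (n : ℝ) ^ (-σ) : ℝ) := by
    rw [← Complex.summable_ofReal]
    exact hsum.congr fun n ↦ (hterm n)
  have hzeta : ‖dedekindZeta K σ‖ = ∑' n : ℕ, (a n * (n : ℝ) ^ (-σ) : ℝ) := by
    rw [dedekindZeta, LSeries, tsum_congr hterm, ← Complex.ofReal_tsum,
      Complex.norm_of_nonneg (tsum_nonneg fun n ↦ by positivity)]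
  have hfin (n : ℕ) : Finite {I : Ideal (𝓞 K) // Ideal.absNorm I = n} :=
    Ideal.finite_setOfPred_absNorm_eq n
  have hfib (n : ℕ) : HasSum (fun I : {I : Ideal (𝓞 K) // Ideal.absNorm I = n} ↦
      (Ideal.absNorm (I : Ideal (𝓞 K)) : ℝ) ^ (-σ)) (a n * (n : ℝ) ^ (-σ)) := by
    have := Fintype.ofFinite {I : Ideal (𝓞 K) // Ideal.absNorm I = n}
    convert hasSum_fintype _
    rw [Finset.sum_congr rfl fun (I : {I : Ideal (𝓞 K) // Ideal.absNorm I = n}) _ ↦ by rw [I.2],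
      Finset.sum_const, nsmul_eq_mul, Finset.card_univ, ← Nat.card_eq_fintype_card]
  rw [← (Equiv.sigmaFiberEquiv (Ideal.absNorm : Ideal (𝓞 K) → ℕ)).hasSum_iff, hzeta]
  have hS : Summable ((fun I : Ideal (𝓞 K) ↦ (Ideal.absNorm I : ℝ) ^ (-σ)) ∘
      (Equiv.sigmaFiberEquiv (Ideal.absNorm : Ideal (𝓞 K) → ℕ))) := by
    rw [summable_sigma_of_nonneg fun x ↦ by simp only [Function.comp_apply]; positivity]
    exact ⟨fun n ↦ (hfib n).summable, hsumR.congr fun n ↦ (hfib n).tsum_eq.symm⟩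
  convert hS.hasSum
  rw [hS.tsum_sigma]
  exact tsum_congr fun n ↦ (hfib n).tsum_eq.symm

/-- The sum of `N(𝔞)^{-σ}` over all ideals is `O(1 / (σ - 1))`. -/
theorem exists_eventually_mul_tsum_absNorm_le :
    ∃ B : ℝ, ∀ᶠ x : ℝ in 𝓝[>] 0, x * ∑' I : Ideal (𝓞 K), (Ideal.absNorm I : ℝ) ^ (-(1 + x)) ≤ B := by
  refine ⟨‖(dedekindZeta_residue K : ℂ)‖ + 1, ?_⟩
  have h1 := (tendsto_sub_one_mul_dedekindZeta_nhdsGT K).norm.eventually_le_const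
    (lt_add_one _)
  have h2 : Tendsto (fun x : ℝ ↦ 1 + x) (𝓝[>] 0) (𝓝[>] 1) := by
    refine tendsto_nhdsWithin_iff.mpr ⟨?_, ?_⟩
    · refine ((continuous_const.add continuous_id).tendsto' _ _ (by simp)).mono_left
        nhdsWithin_le_nhds
    · filter_upwards [self_mem_nhdsWithin] with x hx using by simpa using hx
  filter_upwards [h2.eventually h1, self_mem_nhdsWithin] with x hx hx0
  rw [(hasSum_absNorm_rpow_dedekindZeta K (by simpa using hx0)).tsum_eq]
  refine le_trans (le_of_eq ?_) hx
  rw [norm_mul]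
  congr 1
  simp [abs_of_pos (Set.mem_Ioi.mp hx0)]

end IdealSums

section AngularPower

/-- The function `z ↦ (z / |z|) ^ l * |z| ^ (-2 s)`. -/
noncomputable def angularPower (l : ℕ) (s z : ℂ) : ℂ :=
  (z / ‖z‖) ^ l * Complex.exp (-2 * s * Real.log ‖z‖)

theorem angularPower_zero {l : ℕ} (hl : l ≠ 0) (s : ℂ) : angularPower l s 0 = 0 := by
  simp [angularPower, hl]

theorem norm_angularPower {l : ℕ} (s : ℂ) {z : ℂ} (hz : z ≠ 0) :
    ‖angularPower l s z‖ = ‖z‖ ^ (-2 * s.re) := by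
  rw [angularPower, norm_mul, norm_pow, norm_div, Complex.norm_real, norm_norm,
    div_self (norm_ne_zero_iff.mpr hz), one_pow, one_mul, Complex.norm_exp,
    Real.rpow_def_of_pos (norm_pos_iff.mpr hz), Complex.re_mul_ofReal]
  simp [mul_comm]

theorem angularPower_mul (l : ℕ) (s : ℂ) {z w : ℂ} (hz : z ≠ 0) (hw : w ≠ 0) :
    angularPower l s (z * w) = angularPower l s z * angularPower l s w := by
  simp only [angularPower, norm_mul,
    Real.log_mul (norm_ne_zero_iff.mpr hz) (norm_ne_zero_iff.mpr hw), Complex.ofReal_mul,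
    Complex.ofReal_add, mul_add, Complex.exp_add, mul_div_mul_comm, mul_pow]
  ring

theorem differentiable_angularPower (l : ℕ) (z : ℂ) :
    Differentiable ℂ fun s ↦ angularPower l s z := by
  unfold angularPower; fun_prop

theorem continuousAt_angularPower (l : ℕ) (s : ℂ) {z : ℂ} (hz : z ≠ 0) :
    ContinuousAt (angularPower l s) z := by
  unfold angularPower
  have hz' : ‖z‖ ≠ 0 := norm_ne_zero_iff.mpr hz
  have : (‖z‖ : ℂ) ≠ 0 := Complex.ofReal_ne_zero.mpr hz'
  have h1 : ContinuousAt (fun z : ℂ ↦ (‖z‖ : ℂ)) z :=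
    (Complex.continuous_ofReal.comp continuous_norm).continuousAt
  have h2 : ContinuousAt (fun z : ℂ ↦ ((Real.log ‖z‖ : ℝ) : ℂ)) z :=
    Complex.continuous_ofReal.continuousAt.comp
      ((Real.continuousAt_log hz').comp continuous_norm.continuousAt)
  exact ((continuousAt_id.div h1 this).pow l).mul
    (Complex.continuous_exp.continuousAt.comp (continuousAt_const.mul h2))

theorem norm_pow_sub_pow_le_of_norm_eq_one {u v : ℂ} (hu : ‖u‖ = 1) (hv : ‖v‖ = 1) (l : ℕ) :
    ‖u ^ l - v ^ l‖ ≤ l * ‖u - v‖ := by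
  induction l with
  | zero => simp
  | succ n ih =>
    calc ‖u ^ (n + 1) - v ^ (n + 1)‖ = ‖u ^ n * (u - v) + (u ^ n - v ^ n) * v‖ := by ring_nf
      _ ≤ ‖u ^ n * (u - v)‖ + ‖(u ^ n - v ^ n) * v‖ := norm_add_le _ _
      _ = ‖u - v‖ + ‖u ^ n - v ^ n‖ := by simp [hu, hv]
      _ ≤ ‖u - v‖ + n * ‖u - v‖ := by gcongr
      _ = _ := by push_cast; ring

theorem norm_angularPower_sub_le_of_le {l : ℕ} {B c σ₀ : ℝ} {s z w : ℂ} (hs : ‖s‖ ≤ B)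
    (hσ : σ₀ ≤ s.re) (hz : 1 ≤ ‖z‖) (hcz : 2 * c ≤ ‖z‖) (hw : ‖w - z‖ ≤ c) :
    ‖angularPower l s w - angularPower l s z‖ ≤
      (4 * B * c * Real.exp (2 * B) + 2 * l * c) * ‖z‖ ^ (-(2 * σ₀ + 1)) := by
  have hB : 0 ≤ B := (norm_nonneg _).trans hs
  have hc : 0 ≤ c := (norm_nonneg _).trans hw
  have hz0 : 0 < ‖z‖ := one_pos.trans_le hz
  have hwz : |‖w‖ - ‖z‖| ≤ c := (abs_norm_sub_norm_le w z).trans hw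
  obtain ⟨hwz1, hwz2⟩ := abs_le.mp hwz
  have hw0 : ‖z‖ / 2 ≤ ‖w‖ := by linarith
  have hw1 : 0 < ‖w‖ := by linarith
  set δ := Real.log ‖w‖ - Real.log ‖z‖ with hδ
  have hδle : |δ| ≤ 2 * c / ‖z‖ := by
    rw [abs_le']
    constructor
    · have := Real.log_le_sub_one_of_pos (div_pos hw1 hz0)
      rw [Real.log_div hw1.ne' hz0.ne'] at this
      refine this.trans ?_
      rw [div_sub_one hz0.ne']
      gcongr; linarith
    · have := Real.log_le_sub_one_of_pos (div_pos hz0 hw1)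
      rw [Real.log_div hz0.ne' hw1.ne'] at this
      rw [hδ, neg_sub]
      refine this.trans ?_
      rw [div_sub_one hw1.ne', div_le_div_iff₀ hw1 hz0]
      nlinarith
  have hδ1 : 2 * c / ‖z‖ ≤ 1 := by rwa [div_le_one hz0]
  set v : ℂ := -2 * s * δ with hv
  have hvle : ‖v‖ ≤ 2 * B * (2 * c / ‖z‖) := by
    rw [hv, norm_mul, norm_mul, Complex.norm_real, norm_neg, Complex.norm_ofNat, Real.norm_eq_abs]
    gcongr
  have hvle' : ‖v‖ ≤ 2 * B := hvle.trans (mul_le_of_le_one_right (by positivity) hδ1)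
  have hexp : ‖Complex.exp v - 1‖ ≤ 2 * B * (2 * c / ‖z‖) * Real.exp (2 * B) := by
    have := Complex.norm_exp_sub_sum_le_norm_mul_exp v 1
    simp only [Finset.range_one, Finset.sum_singleton, pow_zero, Nat.factorial_zero, Nat.cast_one,
      div_one, pow_one] at this
    refine this.trans ?_
    gcongr
  set u₁ := w / ‖w‖
  set u₂ := z / ‖z‖
  have hwC : (‖w‖ : ℂ) ≠ 0 := Complex.ofReal_ne_zero.mpr hw1.ne'
  have hzC : (‖z‖ : ℂ) ≠ 0 := Complex.ofReal_ne_zero.mpr hz0.ne'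
  have hu₁ : ‖u₁‖ = 1 := by simp [u₁, hw1.ne']
  have hu₂ : ‖u₂‖ = 1 := by simp [u₂, hz0.ne']
  have hu : ‖u₁ - u₂‖ ≤ 2 * c / ‖z‖ := by
    have : u₁ - u₂ = ((w - z) + u₁ * ((‖z‖ - ‖w‖ : ℝ) : ℂ)) / ‖z‖ := by
      simp only [u₁, u₂]; field_simp; push_cast; ring
    rw [this, norm_div, Complex.norm_real, norm_norm]
    gcongr
    refine (norm_add_le _ _).trans ?_
    rw [norm_mul, hu₁, one_mul, Complex.norm_real, Real.norm_eq_abs, abs_sub_comm]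
    linarith
  have hmain : angularPower l s w - angularPower l s z =
      Complex.exp (-2 * s * Real.log ‖z‖) *
        (u₁ ^ l * (Complex.exp v - 1) + (u₁ ^ l - u₂ ^ l)) := by
    have : Complex.exp (-2 * s * Real.log ‖w‖)
        = Complex.exp (-2 * s * Real.log ‖z‖) * Complex.exp v := by
      rw [← Complex.exp_add, hv, hδ]; congr 1; push_cast; ring
    simp only [angularPower, this]; ring
  have hnorm : ‖Complex.exp (-2 * s * Real.log ‖z‖)‖ ≤ ‖z‖ ^ (-2 * σ₀) := by
    rw [Complex.norm_exp, Real.rpow_def_of_pos hz0, Complex.re_mul_ofReal]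
    have := Real.log_nonneg hz
    simp only [Complex.mul_re, Complex.neg_re, Complex.re_ofNat, Complex.neg_im, Complex.im_ofNat]
    apply Real.exp_le_exp.mpr
    nlinarith
  rw [hmain, norm_mul]
  calc _ ≤ ‖z‖ ^ (-2 * σ₀) * (2 * B * (2 * c / ‖z‖) * Real.exp (2 * B) + l * (2 * c / ‖z‖)) := by
        gcongr
        refine (norm_add_le _ _).trans (add_le_add ?_ ?_)
        · rw [norm_mul, norm_pow, hu₁, one_pow, one_mul]; exact hexp
        · exact (norm_pow_sub_pow_le_of_norm_eq_one hu₁ hu₂ l).trans (by gcongr)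
    _ = _ := by
        rw [show -(2 * σ₀ + 1) = -2 * σ₀ - 1 by ring, Real.rpow_sub_one hz0.ne']
        field_simp
        ring

theorem exists_norm_angularPower_sub_le {l : ℕ} (hl : l ≠ 0) {B c σ₀ : ℝ} (hc : 0 ≤ c)
    (hB : 0 ≤ B) (hσ₀ : 0 ≤ σ₀) :
    ∃ C : ℝ, ∀ s : ℂ, ‖s‖ ≤ B → σ₀ ≤ s.re → ∀ z w : ℂ, (z = 0 ∨ 1 ≤ ‖z‖) → (w = 0 ∨ 1 ≤ ‖w‖) →
      ‖w - z‖ ≤ c →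
      ‖angularPower l s w - angularPower l s z‖ ≤ C * (1 + ‖z‖) ^ (-(2 * σ₀ + 1)) := by
  set p := 2 * σ₀ + 1 with hp
  have hp0 : 0 < p := by positivity
  set D := 4 * B * c * Real.exp (2 * B) + 2 * l * c with hD
  have hD0 : 0 ≤ D := by positivity
  refine ⟨2 * (2 + 2 * c) ^ p + D * 2 ^ p, fun s hs hσ z w hz hw hwz ↦ ?_⟩
  have hle {x : ℂ} (hx : x = 0 ∨ 1 ≤ ‖x‖) : ‖angularPower l s x‖ ≤ 1 := by
    rcases eq_or_ne x 0 with rfl | h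
    · simp [angularPower_zero hl]
    · rw [norm_angularPower s h]
      exact Real.rpow_le_one_of_one_le_of_nonpos (hx.resolve_left h) (by linarith)
  rw [add_mul]
  have h1z : 0 < 1 + ‖z‖ := by positivity
  by_cases h : ‖z‖ ≤ 1 + 2 * c
  · refine le_add_of_le_of_nonneg ?_ (by positivity)
    calc _ ≤ ‖angularPower l s w‖ + ‖angularPower l s z‖ := norm_sub_le _ _
      _ ≤ 1 + 1 := add_le_add (hle hw) (hle hz)
      _ = 2 * ((1 + ‖z‖) ^ p * (1 + ‖z‖) ^ (-p)) := by
        rw [← Real.rpow_add h1z, add_neg_cancel, Real.rpow_zero]; norm_num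
      _ ≤ 2 * ((2 + 2 * c) ^ p * (1 + ‖z‖) ^ (-p)) := by
        gcongr 2 * (?_ * _)
        exact Real.rpow_le_rpow h1z.le (by linarith) hp0.le
      _ = _ := by ring
  · push Not at h
    have hz1 : 1 ≤ ‖z‖ := by linarith
    refine le_add_of_nonneg_of_le (by positivity) ?_
    refine (norm_angularPower_sub_le_of_le hs hσ hz1 (by linarith) hwz).trans ?_
    rw [mul_assoc D]
    refine mul_le_mul_of_nonneg_left ?_ hD0
    calc ‖z‖ ^ (-p) ≤ ((1 + ‖z‖) / 2) ^ (-p) :=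
          Real.rpow_le_rpow_of_nonpos (by positivity) (by linarith) (by linarith)
      _ = _ := by
        rw [Real.div_rpow h1z.le zero_le_two, Real.rpow_neg zero_le_two, div_inv_eq_mul, mul_comm]

end AngularPower

section ImaginaryQuadratic

variable {K : Type*} [Field K] [NumberField K]

theorem norm_embedding_sq (hdeg : Module.finrank ℚ K = 2) (himag : IsEmpty (K →+* ℝ))
    (emb : K →+* ℂ) (α : 𝓞 K) :
    ‖emb (α : K)‖ ^ 2 = (Ideal.absNorm (Ideal.span {α}) : ℝ) := by
  classical
  have hc (w : InfinitePlace K) : w.IsComplex := by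
    rw [← InfinitePlace.not_isReal_iff_isComplex]
    intro h
    exact himag.false (InfinitePlace.embedding_of_isReal h)
  have hsum := InfinitePlace.sum_mult_eq (K := K)
  have hm (w : InfinitePlace K) : w.mult = 2 := InfinitePlace.mult_isComplex ⟨w, hc w⟩
  rw [hdeg, Finset.sum_congr rfl fun w _ ↦ hm w, Finset.sum_const, smul_eq_mul] at hsum
  have hcard : Fintype.card (InfinitePlace K) = 1 := by
    rw [← Finset.card_univ]; omega
  obtain ⟨w, hw⟩ := Fintype.card_eq_one_iff.mp hcard
  have h1 := InfinitePlace.prod_eq_abs_norm (α : K)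
  rw [Fintype.prod_eq_single w fun v hv ↦ absurd (hw v) hv, hm, ← hw (InfinitePlace.mk emb),
    InfinitePlace.apply] at h1
  rw [h1, Ideal.absNorm_span_singleton, ← Algebra.coe_norm_int]
  simp [Nat.cast_natAbs]

theorem one_le_norm_embedding (hdeg : Module.finrank ℚ K = 2) (himag : IsEmpty (K →+* ℝ))
    (emb : K →+* ℂ) {α : 𝓞 K} (hα : α ≠ 0) : 1 ≤ ‖emb (α : K)‖ := by
  have h := norm_embedding_sq hdeg himag emb α
  have h1 : (1 : ℝ) ≤ Ideal.absNorm (Ideal.span {α}) := by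
    exact_mod_cast Nat.one_le_iff_ne_zero.mpr (by simpa [Ideal.absNorm_eq_zero_iff] using hα)
  rw [← h] at h1
  exact (one_le_sq_iff₀ (norm_nonneg _)).mp h1

theorem summable_one_add_norm_embedding_rpow (hdeg : Module.finrank ℚ K = 2)
    (himag : IsEmpty (K →+* ℝ)) (emb : K →+* ℂ) {p : ℝ} (hp : 2 < p) :
    Summable fun α : 𝓞 K ↦ (1 + ‖emb (α : K)‖) ^ (-p) := by
  let φ : 𝓞 K →ₗ[ℤ] ℂ := (emb.comp (algebraMap (𝓞 K) K)).toAddMonoidHom.toIntLinearMap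
  have hφ (α : 𝓞 K) : φ α = emb (α : K) := rfl
  have hinj : Function.Injective φ := emb.injective.comp RingOfIntegers.coe_injective
  let L : Submodule ℤ ℂ := LinearMap.range φ
  let e : 𝓞 K ≃ₗ[ℤ] L := LinearEquiv.ofInjective φ hinj
  have hL : Module.finrank ℤ L = 2 := by
    rw [← e.finrank_eq, RingOfIntegers.rank, hdeg]
  have : DiscreteTopology L := by
    refine DiscreteTopology.of_forall_le_dist one_pos ?_
    rintro ⟨_, α, rfl⟩ ⟨_, β, rfl⟩ hne
    rw [Subtype.dist_eq, dist_eq_norm, ← map_sub, hφ]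
    refine one_le_norm_embedding hdeg himag emb (sub_ne_zero.mpr ?_)
    rintro rfl; exact hne rfl
  have h1 : Summable fun α : 𝓞 K ↦ ‖emb (α : K)‖ ^ (-p) :=
    (e.toEquiv.summable_iff (f := fun z : L ↦ ‖z‖ ^ (-p))).mpr
      (ZLattice.summable_norm_rpow L (-p) (by rw [hL]; push_cast; linarith))
  refine Summable.of_norm_bounded_eventually h1 ?_
  filter_upwards [(Set.finite_singleton (0 : 𝓞 K)).compl_mem_cofinite] with α hα
  have := one_le_norm_embedding hdeg himag emb hα
  rw [Real.norm_of_nonneg (by positivity)]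
  exact Real.rpow_le_rpow_of_nonpos (by linarith) (by linarith) (by linarith)

theorem denseRange_embedding (himag : IsEmpty (K →+* ℝ)) (emb : K →+* ℂ) : DenseRange emb := by
  have : ¬ ComplexEmbedding.IsReal emb := fun h ↦ himag.false h.embedding
  obtain ⟨ω, hω⟩ : ∃ ω : K, (emb ω).im ≠ 0 := by
    by_contra! h
    exact this (RingHom.ext fun x ↦ Complex.conj_eq_iff_im.mpr (h x))
  have h1 : DenseRange (Prod.map ((↑) : ℚ → ℝ) ((↑) : ℚ → ℝ)) :=
    Rat.denseRange_cast.prodMap Rat.denseRange_cast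
  let g : ℝ × ℝ → ℂ := fun x ↦ x.1 + x.2 * emb ω
  have hg : Continuous g := by fun_prop
  have hgs : Function.Surjective g := by
    intro z
    refine ⟨(z.re - z.im / (emb ω).im * (emb ω).re, z.im / (emb ω).im), ?_⟩
    apply Complex.ext <;> simp [g, hω]
  refine (hgs.denseRange.comp h1 hg).mono ?_
  rintro _ ⟨⟨a, b⟩, rfl⟩
  exact ⟨a + b * ω, by simp [g]⟩

/-- Some `γ ≡ 1` has `(γ / |γ|) ^ l * |γ| ^ (2 - 2 s) ≠ 1`. -/
theorem exists_angularPower_ne_one (himag : IsEmpty (K →+* ℝ)) (emb : K →+* ℂ)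
    {𝔑 : Ideal (𝓞 K)} (h𝔑 : 𝔑 ≠ ⊥) {l : ℕ} (hl : l ≠ 0) (s : ℂ) :
    ∃ γ : 𝓞 K, γ ≠ 0 ∧ γ - 1 ∈ 𝔑 ∧ angularPower l s (emb (γ : K)) ≠ 1 := by
  by_contra! h
  set φ := angularPower l s with hφ
  obtain ⟨M, hM, hM0⟩ : ∃ M : ℕ, (M : 𝓞 K) ∈ 𝔑 ∧ M ≠ 0 :=
    ⟨Ideal.absNorm 𝔑, Ideal.absNorm_mem 𝔑, by simpa [Ideal.absNorm_eq_zero_iff] using h𝔑⟩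
  have hne {x : K} (hx : x ≠ 0) : emb x ≠ 0 := (map_ne_zero emb).mpr hx
  have hint (α : 𝓞 K) (hα : α ≠ 0) : φ (emb (α : K)) = 1 := by
    have hαK : (α : K) ≠ 0 := RingOfIntegers.coe_ne_zero_iff.mpr hα
    have hlim : Filter.Tendsto (fun k : ℕ ↦ (1 / (k : ℂ) + M * emb (α : K)) / (1 / (k : ℂ) + M))
        Filter.atTop (nhds ((0 + M * emb (α : K)) / (0 + M))) := by
      have h0 := tendsto_one_div_atTop_nhds_zero_nat (𝕜 := ℂ)
      refine (h0.add_const _).div (h0.add_const _) (by simpa using hM0)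
    rw [zero_add, zero_add, mul_div_cancel_left₀ _ (Nat.cast_ne_zero.mpr hM0)] at hlim
    refine tendsto_nhds_unique
      ((continuousAt_angularPower l s (hne hαK)).tendsto.comp hlim)
      (tendsto_const_nhds.congr' ?_)
    have hev := hlim.eventually_ne (hne hαK)
    filter_upwards [hev, Filter.eventually_ne_atTop 0] with k hk hk0
    have hkC : (k : ℂ) ≠ 0 := Nat.cast_ne_zero.mpr hk0
    have e1 : (1 / (k : ℂ) + M * emb (α : K)) / (1 / (k : ℂ) + M)
      = emb ((1 + k * M * α : 𝓞 K) : K) / emb ((1 + k * M : 𝓞 K) : K) := by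
      simp only [map_add, map_one, map_mul, map_natCast]
      rw [← mul_div_mul_left _ _ hkC]
      congr 1 <;> field_simp
    rw [Function.comp_apply, e1]
    rw [e1] at hk
    have hk1 : emb ((1 + k * M * α : 𝓞 K) : K) ≠ 0 := fun h0 ↦ hk (by rw [h0, zero_div])
    have hk2 : emb ((1 + k * M : 𝓞 K) : K) ≠ 0 := fun h0 ↦ hk (by rw [h0, div_zero])
    have hg (γ : 𝓞 K) (hγ : emb (γ : K) ≠ 0) (hγ1 : γ - 1 ∈ 𝔑) : φ (emb (γ : K)) = 1 :=
      h γ (by rintro rfl; simp at hγ) hγ1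
    have m1 := hg _ hk1 (by
      rw [add_sub_cancel_left, mul_right_comm]; exact 𝔑.mul_mem_left _ hM)
    have m2 := hg _ hk2 (by rw [add_sub_cancel_left]; exact 𝔑.mul_mem_left _ hM)
    have := angularPower_mul l s (div_ne_zero hk1 hk2) hk2
    rw [div_mul_cancel₀ _ hk2] at this
    rw [← hφ, m1, m2, mul_one] at this
    exact this
  have hK (x : K) (hx : x ≠ 0) : φ (emb x) = 1 := by
    obtain ⟨a, b, hb, rfl⟩ := IsFractionRing.div_surjective (A := 𝓞 K) x
    have hb0 : b ≠ 0 := nonZeroDivisors.ne_zero hb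
    have ha0 : a ≠ 0 := by rintro rfl; simp at hx
    have hbK : emb (algebraMap (𝓞 K) K b) ≠ 0 := hne (RingOfIntegers.coe_ne_zero_iff.mpr hb0)
    have := angularPower_mul l s (hne hx) hbK
    rw [← map_mul, div_mul_cancel₀ _ (RingOfIntegers.coe_ne_zero_iff.mpr hb0)] at this
    rw [← hφ, hint a ha0, hint b hb0, mul_one] at this
    exact this.symm
  have hall (z : ℂ) (hz : z ≠ 0) : φ z = 1 := by
    obtain ⟨u, hu, hlim⟩ := mem_closure_iff_seq_limit.mp (denseRange_embedding himag emb z)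
    refine tendsto_nhds_unique ((continuousAt_angularPower l s hz).tendsto.comp hlim)
      (tendsto_const_nhds.congr' ?_)
    filter_upwards [hlim.eventually_ne hz] with n hn
    obtain ⟨x, hx⟩ := hu n
    rw [Function.comp_apply, ← hx]
    exact (hK x (by rintro rfl; simp at hx; exact hn hx.symm)).symm
  have := hall (Complex.exp (Real.pi / l * Complex.I)) (Complex.exp_ne_zero _)
  have hn : ‖Complex.exp (Real.pi / l * Complex.I)‖ = 1 := by
    have := Complex.norm_exp_ofReal_mul_I (Real.pi / l)
    push_cast at this; exact this
  rw [hφ, angularPower, hn, Complex.ofReal_one, div_one, Real.log_one, Complex.ofReal_zero,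
    mul_zero, Complex.exp_zero, mul_one, ← Complex.exp_nat_mul, ← mul_assoc,
    mul_div_cancel₀ _ (Nat.cast_ne_zero.mpr hl), Complex.exp_pi_mul_I] at this
  norm_num at this

end ImaginaryQuadratic

section UnitaryHecke

variable {K : Type*} [Field K]

theorem isCoprime_span_singleton_of_sub_one_mem {𝔑 : Ideal (𝓞 K)} {α : 𝓞 K} (h : α - 1 ∈ 𝔑) :
    IsCoprime (Ideal.span {α}) 𝔑 :=
  Ideal.isCoprime_iff_exists.mpr
    ⟨α, Ideal.mem_span_singleton_self α, 1 - α, by simpa using 𝔑.neg_mem h, by ring⟩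

theorem exists_mul_sub_one_mem_of_isCoprime {𝔑 : Ideal (𝓞 K)} {α : 𝓞 K}
    (h : IsCoprime (Ideal.span {α}) 𝔑) : ∃ γ, α * γ - 1 ∈ 𝔑 := by
  obtain ⟨x, hx, y, hy, hxy⟩ := Ideal.isCoprime_iff_exists.mp h
  obtain ⟨γ, rfl⟩ := Ideal.mem_span_singleton.mp hx
  exact ⟨γ, by rw [← hxy]; simpa using 𝔑.neg_mem hy⟩

/-- `χ` is a unitary Hecke character modulo `𝔑` of infinity type `l`, extended by zero to the
ideals that are not coprime to `𝔑`. -/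
structure IsUnitaryHecke (emb : K →+* ℂ) (𝔑 : Ideal (𝓞 K)) (l : ℕ)
    (χ : Ideal (𝓞 K) →*₀ ℂ) : Prop where
  eq_zero : ∀ 𝔞, ¬ IsCoprime 𝔞 𝔑 → χ 𝔞 = 0
  norm_eq_one : ∀ 𝔞, IsCoprime 𝔞 𝔑 → ‖χ 𝔞‖ = 1
  apply_span : ∀ α : 𝓞 K, α - 1 ∈ 𝔑 →
    χ (Ideal.span {α}) = (emb (α : K) / ‖emb (α : K)‖) ^ l

namespace IsUnitaryHecke

variable {emb : K →+* ℂ} {𝔑 : Ideal (𝓞 K)} {l : ℕ} {χ : Ideal (𝓞 K) →*₀ ℂ}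

theorem mul_self (h : IsUnitaryHecke emb 𝔑 l χ) : IsUnitaryHecke emb 𝔑 (2 * l) (χ * χ) where
  eq_zero 𝔞 h𝔞 := by change χ 𝔞 * χ 𝔞 = 0; rw [h.eq_zero 𝔞 h𝔞, mul_zero]
  norm_eq_one 𝔞 h𝔞 := by change ‖χ 𝔞 * χ 𝔞‖ = 1; rw [norm_mul, h.norm_eq_one 𝔞 h𝔞, mul_one]
  apply_span α hα := by
    change χ _ * χ _ = _
    rw [h.apply_span α hα, two_mul, pow_add]

theorem norm_le_one (h : IsUnitaryHecke emb 𝔑 l χ) (𝔞 : Ideal (𝓞 K)) : ‖χ 𝔞‖ ≤ 1 := by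
  by_cases h𝔞 : IsCoprime 𝔞 𝔑
  · exact (h.norm_eq_one 𝔞 h𝔞).le
  · simp [h.eq_zero 𝔞 h𝔞]

theorem ne_top (h : IsUnitaryHecke emb 𝔑 l χ) : 𝔑 ≠ ⊤ := by
  rintro rfl
  have := h.norm_eq_one 0 (by rw [← Ideal.one_eq_top]; exact isCoprime_one_right)
  rw [map_zero, norm_zero] at this
  exact zero_ne_one this

/-- A Hecke character differs from its infinity type by a function that is periodic modulo
`𝔑`. -/
theorem exists_apply_span_eq (h : IsUnitaryHecke emb 𝔑 l χ) (α : 𝓞 K) {c : 𝓞 K} (hc : c ∈ 𝔑) :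
    ∃ κ : ℂ, ‖κ‖ ≤ 1 ∧ χ (Ideal.span {α}) = κ * (emb (α : K) / ‖emb (α : K)‖) ^ l ∧
      χ (Ideal.span {α + c}) = κ * (emb (α + c : 𝓞 K) / ‖emb (α + c : 𝓞 K)‖) ^ l := by
  by_cases hα : IsCoprime (Ideal.span {α}) 𝔑
  · obtain ⟨γ, hγ⟩ := exists_mul_sub_one_mem_of_isCoprime hα
    have hγ0 : γ ≠ 0 := by
      rintro rfl
      refine h.ne_top ((Ideal.eq_top_iff_one 𝔑).mpr ?_)
      simpa using 𝔑.neg_mem hγ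
    have hγc : IsCoprime (Ideal.span {γ}) 𝔑 := by
      have := isCoprime_span_singleton_of_sub_one_mem hγ
      rw [← Ideal.span_singleton_mul_span_singleton] at this
      exact (IsCoprime.mul_left_iff.mp this).2
    have hγ1 := h.norm_eq_one _ hγc
    have hu : ‖emb (γ : K) / ‖emb (γ : K)‖‖ = 1 := by simp [hγ0]
    have key (α' : 𝓞 K) (h' : α' * γ - 1 ∈ 𝔑) : χ (Ideal.span {α'})
        = (χ (Ideal.span {γ}))⁻¹ * (emb (γ : K) / ‖emb (γ : K)‖) ^ l *
          (emb (α' : K) / ‖emb (α' : K)‖) ^ l := by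
      have hne : χ (Ideal.span {γ}) ≠ 0 := by rw [← norm_ne_zero_iff, hγ1]; exact one_ne_zero
      have hm : emb (α' * γ : 𝓞 K) = emb (α' : K) * emb (γ : K) := by simp
      have h2 := h.apply_span _ h'
      rw [← Ideal.span_singleton_mul_span_singleton, map_mul] at h2
      rw [mul_assoc, eq_inv_mul_iff_mul_eq₀ hne, mul_comm, h2, ← mul_pow, hm, norm_mul,
        Complex.ofReal_mul, mul_comm (emb (α' : K)), mul_comm (‖emb (α' : K)‖ : ℂ),
        mul_div_mul_comm]
    refine ⟨_, ?_, key α hγ, key (α + c) ?_⟩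
    · rw [norm_mul, norm_inv, hγ1, norm_pow, hu]; simp
    · rw [add_mul, add_sub_right_comm]
      exact 𝔑.add_mem hγ (𝔑.mul_mem_right γ hc)
  · refine ⟨0, by simp, ?_, ?_⟩
    · rw [h.eq_zero _ hα, zero_mul]
    · rw [zero_mul]
      refine h.eq_zero _ fun h' ↦ hα ?_
      obtain ⟨γ, hγ⟩ := exists_mul_sub_one_mem_of_isCoprime h'
      have : IsCoprime (Ideal.span {α * γ}) 𝔑 := by
        refine isCoprime_span_singleton_of_sub_one_mem ?_
        rw [add_mul, add_sub_right_comm] at hγ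
        exact (𝔑.add_mem_iff_left (𝔑.mul_mem_right γ hc)).mp hγ
      rw [← Ideal.span_singleton_mul_span_singleton] at this
      exact (IsCoprime.mul_left_iff.mp this).1

end IsUnitaryHecke

variable [NumberField K]

/-- Some power of an ideal coprime to `𝔑` is generated by an element congruent to `1`
modulo `𝔑`. -/
theorem exists_pow_eq_span_singleton {𝔑 𝔞 : Ideal (𝓞 K)} (h𝔑 : 𝔑 ≠ ⊥) (h𝔞 : 𝔞 ≠ ⊥)
    (h : IsCoprime 𝔞 𝔑) : ∃ n ≠ 0, ∃ α : 𝓞 K, α - 1 ∈ 𝔑 ∧ 𝔞 ^ n = Ideal.span {α} := by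
  have h0 : 𝔞 ∈ nonZeroDivisors (Ideal (𝓞 K)) := mem_nonZeroDivisors_of_ne_zero h𝔞
  have hcl : ClassGroup.mk0 (⟨𝔞, h0⟩ ^ Fintype.card (ClassGroup (𝓞 K))) = 1 := by
    rw [map_pow, pow_card_eq_one]
  rw [ClassGroup.mk0_eq_one_iff] at hcl
  obtain ⟨⟨α, hα⟩⟩ := hcl
  simp only [SubmonoidClass.mk_pow, Ideal.submodule_span_eq] at hα
  have : Finite (𝓞 K ⧸ 𝔑) := Ideal.finiteQuotientOfFreeOfNeBot 𝔑 h𝔑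
  have hα1 : IsCoprime (Ideal.span {α}) 𝔑 := hα ▸ h.pow_left
  obtain ⟨γ, hγ⟩ := exists_mul_sub_one_mem_of_isCoprime hα1
  have hu : IsUnit (Ideal.Quotient.mk 𝔑 α) := by
    refine IsUnit.of_mul_eq_one (Ideal.Quotient.mk 𝔑 γ) ?_
    rw [← map_mul, ← sub_eq_zero, ← map_one (Ideal.Quotient.mk 𝔑), ← map_sub]
    exact Ideal.Quotient.eq_zero_iff_mem.mpr hγ
  obtain ⟨u, hu⟩ := hu
  refine ⟨Fintype.card (ClassGroup (𝓞 K)) * Nat.card (𝓞 K ⧸ 𝔑)ˣ,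
    mul_ne_zero Fintype.card_ne_zero Nat.card_pos.ne', α ^ Nat.card (𝓞 K ⧸ 𝔑)ˣ, ?_, ?_⟩
  · rw [← Ideal.Quotient.eq_zero_iff_mem, map_sub, map_pow, ← hu, ← Units.val_pow_eq_pow_val,
      pow_card_eq_one', Units.val_one, map_one, sub_self]
  · rw [pow_mul, hα, Ideal.span_singleton_pow]

open scoped Classical in
theorem exists_isUnitaryHecke (hdeg : Module.finrank ℚ K = 2) (himag : IsEmpty (K →+* ℝ))
    (emb : K →+* ℂ) {𝔑 : Ideal (𝓞 K)} (h𝔑 : 𝔑 ≠ ⊥) {l : ℕ} (hl : l ≠ 0)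
    {ψ : Ideal (𝓞 K) → ℂ}
    (hmul : ∀ 𝔞 𝔟 : Ideal (𝓞 K), IsCoprime 𝔞 𝔑 → IsCoprime 𝔟 𝔑 → ψ (𝔞 * 𝔟) = ψ 𝔞 * ψ 𝔟)
    (hne : ∀ 𝔞 : Ideal (𝓞 K), IsCoprime 𝔞 𝔑 → ψ 𝔞 ≠ 0)
    (halg : ∀ α : 𝓞 K, α - 1 ∈ 𝔑 → ψ (Ideal.span {α}) = emb (α : K) ^ l) :
    ∃ χ : Ideal (𝓞 K) →*₀ ℂ, IsUnitaryHecke emb 𝔑 l χ ∧ ∀ 𝔞, IsCoprime 𝔞 𝔑 →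
      χ 𝔞 = ψ 𝔞 * (Ideal.absNorm 𝔞 : ℂ) ^ (-(l : ℂ) / 2) := by
  have h1 : ψ 1 = 1 := by
    simpa [Ideal.one_eq_top] using halg 1 (by simp)
  have hbot : ¬ IsCoprime (⊥ : Ideal (𝓞 K)) 𝔑 := by
    intro h
    rw [← Ideal.zero_eq_bot, isCoprime_zero_left, Ideal.isUnit_iff] at h
    have := halg 0 (by rw [h]; trivial)
    refine hne ⊥ (by rw [h, ← Ideal.one_eq_top]; exact isCoprime_one_right) ?_
    simpa [hl] using this
  let χ : Ideal (𝓞 K) →*₀ ℂ :=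
    { toFun 𝔞 := if IsCoprime 𝔞 𝔑 then ψ 𝔞 * (Ideal.absNorm 𝔞 : ℂ) ^ (-(l : ℂ) / 2) else 0
      map_zero' := if_neg hbot
      map_one' := by rw [if_pos isCoprime_one_left, h1]; simp
      map_mul' 𝔞 𝔟 := by
        by_cases h𝔞 : IsCoprime 𝔞 𝔑
        · by_cases h𝔟 : IsCoprime 𝔟 𝔑
          · rw [if_pos h𝔞, if_pos h𝔟, if_pos (h𝔞.mul_left h𝔟), hmul 𝔞 𝔟 h𝔞 h𝔟, map_mul,
              Nat.cast_mul, Complex.natCast_mul_natCast_cpow]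
            ring
          · rw [if_neg h𝔟, mul_zero, if_neg fun h ↦ h𝔟 (IsCoprime.mul_left_iff.mp h).2]
        · rw [if_neg h𝔞, zero_mul, if_neg fun h ↦ h𝔞 (IsCoprime.mul_left_iff.mp h).1] }
  have hχ {𝔞 : Ideal (𝓞 K)} (h : IsCoprime 𝔞 𝔑) :
      χ 𝔞 = ψ 𝔞 * (Ideal.absNorm 𝔞 : ℂ) ^ (-(l : ℂ) / 2) := if_pos h
  have hspan (α : 𝓞 K) (hα : α - 1 ∈ 𝔑) :
      χ (Ideal.span {α}) = (emb (α : K) / ‖emb (α : K)‖) ^ l := by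
    have hc := isCoprime_span_singleton_of_sub_one_mem hα
    rw [hχ hc, halg α hα, div_pow, div_eq_mul_inv (_ ^ l)]
    congr 1
    have hsq : ((Ideal.absNorm (Ideal.span {α}) : ℕ) : ℂ) = ((‖emb (α : K)‖ ^ 2 : ℝ) : ℂ) := by
      rw [norm_embedding_sq hdeg himag emb α, Complex.ofReal_natCast]
    rw [hsq, show (-(l : ℂ) / 2) = ((-(l : ℝ) / 2 : ℝ) : ℂ) by push_cast; ring,
      ← Complex.ofReal_cpow (by positivity), ← Real.rpow_natCast, ← Real.rpow_mul (norm_nonneg _),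
      show ((2 : ℕ) : ℝ) * (-(l : ℝ) / 2) = -(l : ℝ) by push_cast; ring,
      Real.rpow_neg (norm_nonneg _), Real.rpow_natCast]
    push_cast; rfl
  refine ⟨χ, ⟨fun 𝔞 h ↦ if_neg h, fun 𝔞 h ↦ ?_, hspan⟩, fun 𝔞 h ↦ hχ h⟩
  obtain ⟨n, hn, α, hα, hpow⟩ := exists_pow_eq_span_singleton h𝔑 (fun h' ↦ hbot (h' ▸ h)) h
  have hα0 : emb (α : K) ≠ 0 := by
    intro h0
    have : α = 0 := by simpa using h0
    refine hbot ?_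
    have hc := isCoprime_span_singleton_of_sub_one_mem hα
    simpa [this] using hc
  refine (pow_eq_one_iff_of_nonneg (norm_nonneg _) hn).mp ?_
  rw [← norm_pow, ← map_pow, hpow, hspan α hα]
  simp [hα0]

/-- The completely multiplicative function `𝔞 ↦ χ(𝔞) N(𝔞)⁻ˢ`. -/
noncomputable def normTwist (χ : Ideal (𝓞 K) →*₀ ℂ) (s : ℂ) : Ideal (𝓞 K) →*₀ ℂ where
  toFun 𝔞 := χ 𝔞 * (Ideal.absNorm 𝔞 : ℂ) ^ (-s)
  map_zero' := by rw [map_zero, zero_mul]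
  map_one' := by rw [map_one, map_one, Nat.cast_one, Complex.one_cpow, one_mul]
  map_mul' 𝔞 𝔟 := by
    rw [map_mul, map_mul, Nat.cast_mul, Complex.natCast_mul_natCast_cpow]
    ring

theorem normTwist_apply (χ : Ideal (𝓞 K) →*₀ ℂ) (s : ℂ) (𝔞 : Ideal (𝓞 K)) :
    normTwist χ s 𝔞 = χ 𝔞 * (Ideal.absNorm 𝔞 : ℂ) ^ (-s) := rfl

theorem norm_normTwist_le {χ : Ideal (𝓞 K) →*₀ ℂ} (hχ : ∀ 𝔞, ‖χ 𝔞‖ ≤ 1) (s : ℂ)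
    (𝔞 : Ideal (𝓞 K)) : ‖normTwist χ s 𝔞‖ ≤ (Ideal.absNorm 𝔞 : ℝ) ^ (-s.re) := by
  rcases eq_or_ne 𝔞 0 with rfl | h
  · rw [map_zero, norm_zero]; positivity
  · have h0 : 0 < Ideal.absNorm 𝔞 :=
      Nat.pos_of_ne_zero fun h' ↦ h (Ideal.absNorm_eq_zero_iff.mp h')
    rw [normTwist_apply, norm_mul, Complex.norm_natCast_cpow_of_pos h0, Complex.neg_re]
    exact mul_le_of_le_one_left (by positivity) (hχ 𝔞)

theorem summable_norm_normTwist {χ : Ideal (𝓞 K) →*₀ ℂ} (hχ : ∀ 𝔞, ‖χ 𝔞‖ ≤ 1) {s : ℂ}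
    (hs : 1 < s.re) : Summable fun 𝔞 ↦ ‖normTwist χ s 𝔞‖ :=
  .of_nonneg_of_le (fun _ ↦ norm_nonneg _) (norm_normTwist_le hχ s)
    (hasSum_absNorm_rpow_dedekindZeta K hs).summable

end UnitaryHecke

section LatticeSum

variable {K : Type*} [Field K] [NumberField K] {emb : K →+* ℂ} {𝔑 : Ideal (𝓞 K)} {l : ℕ}
  {χ : Ideal (𝓞 K) →*₀ ℂ}

theorem norm_embedding_eq_zero_or_one_le (hdeg : Module.finrank ℚ K = 2)
    (himag : IsEmpty (K →+* ℝ)) (emb : K →+* ℂ) (α : 𝓞 K) :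
    emb (α : K) = 0 ∨ 1 ≤ ‖emb (α : K)‖ := by
  rcases eq_or_ne α 0 with rfl | h
  · simp
  · exact .inr (one_le_norm_embedding hdeg himag emb h)

theorem normTwist_span_singleton (hdeg : Module.finrank ℚ K = 2) (himag : IsEmpty (K →+* ℝ))
    (hl : l ≠ 0) {κ : ℂ} {α : 𝓞 K}
    (h : χ (Ideal.span {α}) = κ * (emb (α : K) / ‖emb (α : K)‖) ^ l) (s : ℂ) :
    normTwist χ s (Ideal.span {α}) = κ * angularPower l s (emb (α : K)) := by
  rcases eq_or_ne α 0 with rfl | hα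
  · simp only [Set.singleton_zero, Ideal.span_zero, ← Ideal.zero_eq_bot, map_zero,
      angularPower_zero hl, mul_zero]
  have hz : ‖emb (α : K)‖ ≠ 0 := by simpa using hα
  have hsq : ((Ideal.absNorm (Ideal.span {α}) : ℕ) : ℂ) = ((‖emb (α : K)‖ ^ 2 : ℝ) : ℂ) := by
    rw [norm_embedding_sq hdeg himag emb α, Complex.ofReal_natCast]
  rw [normTwist_apply, h, angularPower, mul_assoc, hsq, Complex.cpow_def_of_ne_zero
    (by exact_mod_cast pow_ne_zero 2 hz), ← Complex.ofReal_log (by positivity), Real.log_pow]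
  congr 3
  push_cast
  ring

theorem differentiable_normTwist (χ : Ideal (𝓞 K) →*₀ ℂ) (𝔞 : Ideal (𝓞 K)) :
    Differentiable ℂ fun s ↦ normTwist χ s 𝔞 := by
  rcases eq_or_ne 𝔞 0 with rfl | h
  · simp only [map_zero]; exact differentiable_const _
  · have h0 : (Ideal.absNorm 𝔞 : ℂ) ≠ 0 := by
      exact_mod_cast fun h' ↦ h (Ideal.absNorm_eq_zero_iff.mp h')
    simp only [normTwist_apply]
    exact fun s ↦ (differentiableAt_id.neg.const_cpow (.inl h0)).const_mul _

namespace IsUnitaryHecke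

theorem normTwist_span_of_sub_one_mem (h : IsUnitaryHecke emb 𝔑 l χ)
    (hdeg : Module.finrank ℚ K = 2) (himag : IsEmpty (K →+* ℝ)) (hl : l ≠ 0) {γ : 𝓞 K}
    (hγ : γ - 1 ∈ 𝔑) (s : ℂ) :
    normTwist χ s (Ideal.span {γ}) = angularPower l s (emb (γ : K)) := by
  rw [normTwist_span_singleton hdeg himag hl (κ := 1) (by rw [h.apply_span γ hγ, one_mul]),
    one_mul]

theorem exists_norm_normTwist_sub_le (h : IsUnitaryHecke emb 𝔑 l χ)
    (hdeg : Module.finrank ℚ K = 2) (himag : IsEmpty (K →+* ℝ)) (hl : l ≠ 0) {c : 𝓞 K}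
    (hc : c ∈ 𝔑) {B σ₀ : ℝ} (hB : 0 ≤ B) (hσ₀ : 0 ≤ σ₀) :
    ∃ C : ℝ, ∀ s : ℂ, ‖s‖ ≤ B → σ₀ ≤ s.re → ∀ α : 𝓞 K,
      ‖normTwist χ s (Ideal.span {α + c}) - normTwist χ s (Ideal.span {α})‖ ≤
        C * (1 + ‖emb (α : K)‖) ^ (-(2 * σ₀ + 1)) := by
  obtain ⟨C, hC⟩ := exists_norm_angularPower_sub_le hl (norm_nonneg (emb (c : K))) hB hσ₀
  refine ⟨C, fun s hs hσ α ↦ ?_⟩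
  obtain ⟨κ, hκ, h1, h2⟩ := h.exists_apply_span_eq α hc
  rw [normTwist_span_singleton hdeg himag hl h1, normTwist_span_singleton hdeg himag hl h2,
    ← mul_sub, norm_mul]
  refine (mul_le_of_le_one_left (norm_nonneg _) hκ).trans (hC s hs hσ _ _ ?_ ?_ ?_)
  · exact norm_embedding_eq_zero_or_one_le hdeg himag emb α
  · exact norm_embedding_eq_zero_or_one_le hdeg himag emb (α + c)
  · simp

theorem differentiableOn_tsum_normTwist_sub (h : IsUnitaryHecke emb 𝔑 l χ)
    (hdeg : Module.finrank ℚ K = 2) (himag : IsEmpty (K →+* ℝ)) (hl : l ≠ 0) {c : 𝓞 K}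
    (hc : c ∈ 𝔑) {ι : Type*} {g : ι → 𝓞 K} (hg : Function.Injective g) :
    DifferentiableOn ℂ (fun s ↦ ∑' i, (normTwist χ s (Ideal.span {g i + c}) -
      normTwist χ s (Ideal.span {g i}))) {s | 1 / 2 < s.re} := by
  intro s hs
  rw [Set.mem_ofPred_eq] at hs
  obtain ⟨σ₀, h1, h2⟩ := exists_between hs
  have hB : 0 ≤ ‖s‖ + 1 := by positivity
  obtain ⟨C, hC⟩ := h.exists_norm_normTwist_sub_le hdeg himag hl hc hB (by linarith : 0 ≤ σ₀)
  have hsum := ((summable_one_add_norm_embedding_rpow hdeg himag emb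
    (by linarith : 2 < 2 * σ₀ + 1)).mul_left C).comp_injective hg
  have hopen : IsOpen {s' : ℂ | ‖s'‖ < ‖s‖ + 1 ∧ σ₀ < s'.re} :=
    (isOpen_lt continuous_norm continuous_const).inter
      (isOpen_lt continuous_const Complex.continuous_re)
  refine DifferentiableAt.differentiableWithinAt
    (DifferentiableOn.differentiableAt (s := {s' : ℂ | ‖s'‖ < ‖s‖ + 1 ∧ σ₀ < s'.re}) ?_ ?_)
  · refine Complex.differentiableOn_tsum_of_summable_norm hsum (fun i ↦ ?_) hopen
      fun i s' hs' ↦ hC s' hs'.1.le hs'.2.le (g i)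
    exact ((differentiable_normTwist χ _).sub (differentiable_normTwist χ _)).differentiableOn
  · exact hopen.mem_nhds ⟨by linarith, h2⟩

theorem summable_normTwist_span (h : IsUnitaryHecke emb 𝔑 l χ)
    (hdeg : Module.finrank ℚ K = 2) (himag : IsEmpty (K →+* ℝ)) {s : ℂ} (hs : 1 < s.re) :
    Summable fun α : 𝓞 K ↦ normTwist χ s (Ideal.span {α}) := by
  refine .of_norm_bounded ((summable_one_add_norm_embedding_rpow hdeg himag emb
    (by linarith : 2 < 2 * s.re)).mul_left (2 ^ (2 * s.re))) fun α ↦ ?_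
  rcases eq_or_ne α 0 with rfl | hα
  · simp only [Set.singleton_zero, Ideal.span_zero, ← Ideal.zero_eq_bot, map_zero, norm_zero]
    positivity
  · have h1 := one_le_norm_embedding hdeg himag emb hα
    refine (norm_normTwist_le h.norm_le_one s _).trans ?_
    rw [← norm_embedding_sq hdeg himag emb, ← Real.rpow_natCast, ← Real.rpow_mul (norm_nonneg _)]
    calc ‖emb (α : K)‖ ^ (((2 : ℕ) : ℝ) * -s.re)
        ≤ ((1 + ‖emb (α : K)‖) / 2) ^ (((2 : ℕ) : ℝ) * -s.re) :=
          Real.rpow_le_rpow_of_nonpos (by positivity) (by linarith) (by push_cast; linarith)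
      _ = _ := by
        rw [show ((2 : ℕ) : ℝ) * -s.re = -(2 * s.re) by push_cast; ring,
          Real.div_rpow (by positivity) zero_le_two, Real.rpow_neg zero_le_two (2 * s.re),
          div_inv_eq_mul, mul_comm]

end IsUnitaryHecke

end LatticeSum

theorem exists_differentiableOn_of_mul_eq {ι : Type*} {U V : Set ℂ} (hU : IsOpen U)
    (hU' : IsPreconnected U) (hV : IsOpen V) (hVU : V ⊆ U) (hV' : V.Nonempty) {S : ℂ → ℂ}
    {A E : ι → ℂ → ℂ} (hA : ∀ i, DifferentiableOn ℂ (A i) U)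
    (hE : ∀ i, DifferentiableOn ℂ (E i) U) (h : ∀ i, ∀ s ∈ V, A i s * S s = E i s)
    (hne : ∀ s ∈ U, ∃ i, A i s ≠ 0) :
    ∃ Λ : ℂ → ℂ, DifferentiableOn ℂ Λ U ∧ ∀ s ∈ V, Λ s = S s := by
  obtain ⟨v, hv⟩ := hV'
  have hcomm (i j : ι) : Set.EqOn (fun s ↦ E i s * A j s) (fun s ↦ E j s * A i s) U := by
    refine (((hE i).mul (hA j)).analyticOnNhd hU).eqOn_of_preconnected_of_eventuallyEq
      (((hE j).mul (hA i)).analyticOnNhd hU) hU' (hVU hv) ?_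
    filter_upwards [hV.mem_nhds hv] with s hs
    change E i s * A j s = E j s * A i s
    rw [← h i s hs, ← h j s hs]
    ring
  have : Nonempty ι := ⟨(hne v (hVU hv)).choose⟩
  choose! i hi using hne
  refine ⟨fun s ↦ E (i s) s / A (i s) s, fun s hs ↦ ?_, fun s hs ↦ ?_⟩
  · have hnhds : U ∈ nhds s := hU.mem_nhds hs
    have hd := ((hE (i s)).differentiableAt hnhds).div ((hA (i s)).differentiableAt hnhds) (hi s hs)
    refine (hd.congr_of_eventuallyEq ?_).differentiableWithinAt
    filter_upwards [hnhds, ((hA (i s)).differentiableAt hnhds).continuousAt.eventually_ne (hi s hs)]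
      with t ht hts
    exact (div_eq_div_iff (hi t ht) hts).mpr (hcomm _ _ ht)
  · exact (div_eq_iff (hi s (hVU hs))).mpr (by rw [← h _ s hs, mul_comm])

/-- The elements of an ideal `𝔟` are partitioned by the cosets of `γ𝔟`, with representatives in
any ideal `𝔑` containing `γ - 1`. -/
theorem exists_equiv_prod_ideal.{u} {K : Type u} [Field K] [NumberField K] {𝔑 : Ideal (𝓞 K)}
    {γ : 𝓞 K} (hγ : γ ≠ 0) (hγ1 : γ - 1 ∈ 𝔑) {𝔟 : Ideal (𝓞 K)}
    (h𝔟 : 𝔟 ≠ ⊥) : ∃ (Q : Type u) (_ : Fintype Q) (r : Q → 𝓞 K) (e : Q × 𝔟 ≃ 𝔟),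
      Fintype.card Q = Ideal.absNorm (Ideal.span {γ}) ∧ (∀ q, r q ∈ 𝔑) ∧
      ∀ q β, (e (q, β) : 𝓞 K) = γ * β + r q := by
  set H : AddSubgroup 𝔟 :=
    (Ideal.span {γ} * 𝔟).toAddSubgroup.addSubgroupOf 𝔟.toAddSubgroup with hH
  have hle : (Ideal.span {γ} * 𝔟).toAddSubgroup ≤ 𝔟.toAddSubgroup :=
    (Ideal.mul_le_right : Ideal.span {γ} * 𝔟 ≤ 𝔟)
  have hmemH (x : 𝔟) : x ∈ H ↔ ∃ z ∈ 𝔟, γ * z = x :=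
    AddSubgroup.mem_addSubgroupOf.trans Ideal.mem_span_singleton_mul
  have hindex : H.index = Ideal.absNorm (Ideal.span {γ}) := by
    have h1 := AddSubgroup.relIndex_mul_index hle
    have h2 (I : Ideal (𝓞 K)) : I.toAddSubgroup.index = Ideal.absNorm I := rfl
    rw [h2, h2, map_mul] at h1
    exact Nat.eq_of_mul_eq_mul_right
      (Nat.pos_of_ne_zero (mt Ideal.absNorm_eq_zero_iff.mp h𝔟)) h1
  have hγN : Ideal.absNorm (Ideal.span {γ}) ≠ 0 := by
    simpa [Ideal.absNorm_eq_zero_iff] using hγ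
  have : H.FiniteIndex := ⟨by rwa [hindex]⟩
  have : Finite (𝔟 ⧸ H) := AddSubgroup.finite_quotient_of_finiteIndex
  let r (q : 𝔟 ⧸ H) : 𝔟 := (1 - γ) • q.out
  have hr (q : 𝔟 ⧸ H) : (QuotientAddGroup.mk (r q) : 𝔟 ⧸ H) = q := by
    conv_rhs => rw [← QuotientAddGroup.out_eq' q]
    rw [QuotientAddGroup.eq, hmemH]
    refine ⟨q.out, q.out.2, ?_⟩
    simp only [r, Submodule.coe_add, Submodule.coe_neg, Submodule.coe_smul,
      smul_eq_mul]
    ring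
  have hγmem (β : 𝔟) : γ • β ∈ H := (hmemH _).mpr ⟨β, β.2, rfl⟩
  let f (p : (𝔟 ⧸ H) × 𝔟) : 𝔟 := γ • p.2 + r p.1
  have hmk (p : (𝔟 ⧸ H) × 𝔟) : (QuotientAddGroup.mk (f p) : 𝔟 ⧸ H) = p.1 := by
    conv_rhs => rw [← hr p.1]
    rw [eq_comm, QuotientAddGroup.eq]
    simpa [f] using hγmem p.2
  have hf : Function.Bijective f := by
    constructor
    · rintro ⟨q, β⟩ ⟨q', β'⟩ h
      have hq : q = q' := (hmk (q, β)).symm.trans ((congrArg _ h).trans (hmk (q', β')))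
      subst hq
      have : γ • β = γ • β' := add_right_cancel h
      have h2 : γ * (β : 𝓞 K) = γ * β' := congrArg Subtype.val this
      rw [Subtype.ext (mul_left_cancel₀ hγ h2)]
    · intro x
      have hx : -r (QuotientAddGroup.mk x) + x ∈ H := by
        rw [← QuotientAddGroup.eq, hr]
      obtain ⟨z, hz, hzx⟩ := (hmemH _).mp hx
      refine ⟨(QuotientAddGroup.mk x, ⟨z, hz⟩), Subtype.ext ?_⟩
      change γ * z + (r (QuotientAddGroup.mk x) : 𝓞 K) = x
      rw [hzx]
      simp
  refine ⟨𝔟 ⧸ H, Fintype.ofFinite _, fun q ↦ r q, Equiv.ofBijective f hf, ?_, fun q ↦ ?_,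
    fun q β ↦ rfl⟩
  · rw [← hindex]; exact (@Nat.card_eq_fintype_card _ (Fintype.ofFinite _)).symm
  · exact 𝔑.mul_mem_right _ (by simpa using 𝔑.neg_mem hγ1)

section LatticeSum

variable {K : Type*} [Field K] [NumberField K] {emb : K →+* ℂ} {𝔑 : Ideal (𝓞 K)} {l : ℕ}
  {χ : Ideal (𝓞 K) →*₀ ℂ}

theorem isPreconnected_re_gt (a : ℝ) : IsPreconnected {s : ℂ | a < s.re} :=
  (convex_halfSpace_re_gt a).isPreconnected

namespace IsUnitaryHecke

theorem one_sub_mul_tsum_normTwist (h : IsUnitaryHecke emb 𝔑 l χ)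
    (hdeg : Module.finrank ℚ K = 2) (himag : IsEmpty (K →+* ℝ)) (hl : l ≠ 0) {γ : 𝓞 K}
    (hγ : γ ≠ 0) (hγ1 : γ - 1 ∈ 𝔑) {𝔟 : Ideal (𝓞 K)} (h𝔟 : 𝔟 ≠ ⊥) :
    ∃ E : ℂ → ℂ, DifferentiableOn ℂ E {s | 1 / 2 < s.re} ∧ ∀ s : ℂ, 1 < s.re →
      (1 - angularPower l (s - 1) (emb (γ : K))) *
        ∑' β : 𝔟, normTwist χ s (Ideal.span {(β : 𝓞 K)}) = E s := by
  obtain ⟨Q, _, r, e, hQ, hr, he⟩ := exists_equiv_prod_ideal hγ hγ1 h𝔟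
  have hinj : Function.Injective fun β : 𝔟 ↦ γ * (β : 𝓞 K) :=
    (mul_right_injective₀ hγ).comp Subtype.val_injective
  refine ⟨fun s ↦ ∑ q, ∑' β : 𝔟, (normTwist χ s (Ideal.span {γ * (β : 𝓞 K) + r q}) -
    normTwist χ s (Ideal.span {γ * (β : 𝓞 K)})), ?_, fun s hs ↦ ?_⟩
  · exact DifferentiableOn.fun_sum fun q _ ↦
      h.differentiableOn_tsum_normTwist_sub hdeg himag hl (hr q) hinj
  · have hsum := h.summable_normTwist_span hdeg himag hs
    have hinj' (q : Q) : Function.Injective fun β : 𝔟 ↦ γ * (β : 𝓞 K) + r q :=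
      (add_left_injective (r q)).comp hinj
    have h1 : ∑' β : 𝔟, normTwist χ s (Ideal.span {(β : 𝓞 K)})
        = ∑ q, ∑' β : 𝔟, normTwist χ s (Ideal.span {γ * (β : 𝓞 K) + r q}) := by
      rw [← e.tsum_eq, Summable.tsum_prod, tsum_fintype]
      · simp only [he]
      · exact (hsum.comp_injective Subtype.val_injective).comp_injective e.injective
    have h2 : ∑' β : 𝔟, normTwist χ s (Ideal.span {γ * (β : 𝓞 K)})
        = angularPower l s (emb (γ : K)) * ∑' β : 𝔟, normTwist χ s (Ideal.span {(β : 𝓞 K)}) := by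
      rw [← tsum_mul_left, ← h.normTwist_span_of_sub_one_mem hdeg himag hl hγ1]
      simp only [← map_mul, Ideal.span_singleton_mul_span_singleton]
    have h3 : angularPower l (s - 1) (emb (γ : K))
        = Ideal.absNorm (Ideal.span {γ}) * angularPower l s (emb (γ : K)) := by
      have hz : 0 < ‖emb (γ : K)‖ := by simpa using hγ
      rw [← Complex.ofReal_natCast, ← norm_embedding_sq hdeg himag emb, angularPower, angularPower,
        show -2 * (s - 1) * (Real.log ‖emb (γ : K)‖ : ℂ)
          = (Real.log ‖emb (γ : K)‖ : ℂ) + (Real.log ‖emb (γ : K)‖ : ℂ)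
            + -2 * s * (Real.log ‖emb (γ : K)‖ : ℂ) by ring, Complex.exp_add, Complex.exp_add,
        ← Complex.ofReal_exp, Real.exp_log hz]
      push_cast
      ring
    have h4 (q : Q) : ∑' β : 𝔟, (normTwist χ s (Ideal.span {γ * (β : 𝓞 K) + r q}) -
        normTwist χ s (Ideal.span {γ * (β : 𝓞 K)}))
        = ∑' β : 𝔟, normTwist χ s (Ideal.span {γ * (β : 𝓞 K) + r q}) -
          ∑' β : 𝔟, normTwist χ s (Ideal.span {γ * (β : 𝓞 K)}) :=
      (hsum.comp_injective (hinj' q)).tsum_sub (hsum.comp_injective hinj)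
    beta_reduce
    rw [Finset.sum_congr rfl fun q _ ↦ h4 q, Finset.sum_sub_distrib, ← h1, Finset.sum_const,
      Finset.card_univ, hQ, h2, h3, nsmul_eq_mul]
    ring

theorem exists_differentiableOn_tsum_ideal (h : IsUnitaryHecke emb 𝔑 l χ) (h𝔑 : 𝔑 ≠ ⊥)
    (hdeg : Module.finrank ℚ K = 2) (himag : IsEmpty (K →+* ℝ)) (hl : l ≠ 0)
    {𝔟 : Ideal (𝓞 K)} (h𝔟 : 𝔟 ≠ ⊥) :
    ∃ Λ : ℂ → ℂ, DifferentiableOn ℂ Λ {s | 1 / 2 < s.re} ∧ ∀ s : ℂ, 1 < s.re →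
      Λ s = ∑' β : 𝔟, normTwist χ s (Ideal.span {(β : 𝓞 K)}) := by
  choose E hE hES using fun γ : {γ : 𝓞 K // γ ≠ 0 ∧ γ - 1 ∈ 𝔑} ↦
    h.one_sub_mul_tsum_normTwist hdeg himag hl γ.2.1 γ.2.2 h𝔟
  refine exists_differentiableOn_of_mul_eq (V := {s | 1 < s.re})
    (isOpen_lt continuous_const Complex.continuous_re) (isPreconnected_re_gt _)
    (isOpen_lt continuous_const Complex.continuous_re)
    (fun s (hs : 1 < s.re) ↦ show 1 / 2 < s.re by linarith) ⟨2, by simp⟩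
    (A := fun (γ : {γ : 𝓞 K // γ ≠ 0 ∧ γ - 1 ∈ 𝔑}) s ↦ 1 - angularPower l (s - 1) (emb (γ : 𝓞 K))) (fun γ ↦ ?_)
    hE (fun γ s hs ↦ hES γ s hs) fun s _ ↦ ?_
  · exact (((differentiable_angularPower l _).comp
      (differentiable_id.sub_const 1)).const_sub 1).differentiableOn
  · obtain ⟨γ, hγ, hγ1, hne⟩ := exists_angularPower_ne_one himag emb h𝔑 hl (s - 1)
    exact ⟨⟨γ, hγ, hγ1⟩, sub_ne_zero.mpr hne.symm⟩

end IsUnitaryHecke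

end LatticeSum

section ClassDecomposition

open scoped nonZeroDivisors

theorem finite_units_of_imaginaryQuadratic {K : Type*} [Field K] [NumberField K]
    (hdeg : Module.finrank ℚ K = 2) (himag : IsEmpty (K →+* ℝ)) (emb : K →+* ℂ) :
    Finite (𝓞 K)ˣ := by
  have h := (summable_one_add_norm_embedding_rpow hdeg himag emb
    (by norm_num : (2 : ℝ) < 3)).tendsto_cofinite_zero
  have hfin := h.eventually_lt_const (by positivity : (0 : ℝ) < 2 ^ (-3 : ℝ))
  rw [Filter.eventually_cofinite] at hfin
  have : Finite {α : 𝓞 K | ¬ (1 + ‖emb (α : K)‖) ^ (-3 : ℝ) < 2 ^ (-3 : ℝ)} := hfin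
  refine Finite.of_injective (fun u : (𝓞 K)ˣ ↦
    (⟨u, ?_⟩ : {α : 𝓞 K | ¬ (1 + ‖emb (α : K)‖) ^ (-3 : ℝ) < 2 ^ (-3 : ℝ)})) fun u v huv ↦ ?_
  · have h1 := norm_embedding_sq hdeg himag emb (u : 𝓞 K)
    rw [Ideal.span_singleton_eq_top.mpr u.isUnit, Ideal.absNorm_top, Nat.cast_one,
      pow_eq_one_iff_of_nonneg (norm_nonneg _) two_ne_zero] at h1
    rw [Set.mem_ofPred_eq, h1]
    norm_num
  · exact Units.ext (congrArg Subtype.val huv)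

/-- The nonzero elements of an ideal `𝔟` correspond to the pairs of an ideal in the inverse
class of `𝔟` and a unit. -/
theorem exists_equiv_class_prod_units {R : Type*} [CommRing R] [IsDedekindDomain R]
    {C : ClassGroup R} {𝔟 : (Ideal R)⁰} (h𝔟 : C * ClassGroup.mk0 𝔟 = 1) :
    ∃ e : ((ClassGroup.mk0 : (Ideal R)⁰ →* ClassGroup R) ⁻¹' {C}) × Rˣ ≃
        {β : (𝔟 : Ideal R) // (β : R) ≠ 0},
      ∀ 𝔞 u, Ideal.span {((e (𝔞, u) : (𝔟 : Ideal R)) : R)} = (𝔞 : Ideal R) * 𝔟 := by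
  have hgen (𝔞 : (ClassGroup.mk0 : (Ideal R)⁰ →* ClassGroup R) ⁻¹' {C}) :
      ∃ g : R, (𝔞 : Ideal R) * 𝔟 = Ideal.span {g} := by
    have h1 : ClassGroup.mk0 ((𝔞 : (Ideal R)⁰) * 𝔟) = 1 := by
      rw [map_mul, Set.mem_preimage.mp 𝔞.2, h𝔟]
    rw [ClassGroup.mk0_eq_one_iff] at h1
    exact h1.principal
  choose g hg using hgen
  have hspan (𝔞) (u : Rˣ) : Ideal.span {(u : R) * g 𝔞} = (𝔞 : Ideal R) * 𝔟 := by
    rw [Ideal.span_singleton_mul_left_unit u.isUnit, hg]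
  have hne (𝔞 : (Ideal R)⁰) : (𝔞 : Ideal R) ≠ 0 := nonZeroDivisors.coe_ne_zero 𝔞
  have hg0 (𝔞) : g 𝔞 ≠ 0 := by
    intro h
    have := hg 𝔞
    rw [h, Set.singleton_zero, Ideal.span_zero] at this
    exact mul_ne_zero (hne _) (hne _) this
  have hmem (𝔞) (u : Rˣ) : (u : R) * g 𝔞 ∈ (𝔟 : Ideal R) :=
    Ideal.mul_le_right ((hspan 𝔞 u).le (Ideal.mem_span_singleton_self _))
  let f (p : ((ClassGroup.mk0 : (Ideal R)⁰ →* ClassGroup R) ⁻¹' {C}) × Rˣ) :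
      {β : (𝔟 : Ideal R) // (β : R) ≠ 0} :=
    ⟨⟨p.2 * g p.1, hmem _ _⟩, mul_ne_zero p.2.ne_zero (hg0 _)⟩
  have hf : Function.Bijective f := by
    constructor
    · rintro ⟨𝔞, u⟩ ⟨𝔞', u'⟩ h
      have h1 : (u : R) * g 𝔞 = u' * g 𝔞' :=
        congrArg Subtype.val (congrArg Subtype.val h)
      have h2 : 𝔞 = 𝔞' := by
        refine Subtype.ext (Subtype.ext (mul_right_cancel₀ (hne 𝔟) ?_))
        rw [← hspan 𝔞 u, h1, hspan]
      subst h2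
      rw [Units.ext (mul_right_cancel₀ (hg0 𝔞) h1)]
    · rintro ⟨⟨β, hβ⟩, hβ0⟩
      obtain ⟨𝔞, h𝔞⟩ := Ideal.dvd_span_singleton.mpr hβ
      have hspan0 : Ideal.span {β} ≠ 0 := by simpa using hβ0
      have h𝔞0 : 𝔞 ∈ (Ideal R)⁰ := by
        refine mem_nonZeroDivisors_of_ne_zero ?_
        rintro rfl
        exact hspan0 (by rw [h𝔞, mul_zero])
      have hC : ClassGroup.mk0 (⟨𝔞, h𝔞0⟩ : (Ideal R)⁰) = C := by
        have h1 : ClassGroup.mk0 (⟨𝔞, h𝔞0⟩ * 𝔟 : (Ideal R)⁰) = 1 := by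
          rw [ClassGroup.mk0_eq_one_iff]
          exact ⟨β, by rw [Ideal.submodule_span_eq, h𝔞, mul_comm]; rfl⟩
        rw [map_mul] at h1
        exact mul_right_cancel (h1.trans h𝔟.symm)
      have h2 : Associated (g ⟨⟨𝔞, h𝔞0⟩, hC⟩) β := by
        rw [← Ideal.span_singleton_eq_span_singleton, ← hg, h𝔞, mul_comm]
      obtain ⟨u, hu⟩ := h2
      exact ⟨(⟨⟨𝔞, h𝔞0⟩, hC⟩, u), Subtype.ext (Subtype.ext (by simpa [f, mul_comm] using hu))⟩
  refine ⟨Equiv.ofBijective f hf, fun 𝔞 u ↦ ?_⟩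
  exact hspan 𝔞 u

variable {K : Type*} [Field K] [NumberField K] {emb : K →+* ℂ} {𝔑 : Ideal (𝓞 K)} {l : ℕ}
  {χ : Ideal (𝓞 K) →*₀ ℂ}

namespace IsUnitaryHecke

theorem tsum_ideal_eq_card_units_mul (h : IsUnitaryHecke emb 𝔑 l χ)
    (hdeg : Module.finrank ℚ K = 2) (himag : IsEmpty (K →+* ℝ)) {C : ClassGroup (𝓞 K)}
    {𝔟 : (Ideal (𝓞 K))⁰} (h𝔟 : C * ClassGroup.mk0 𝔟 = 1) {s : ℂ} (hs : 1 < s.re) :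
    ∑' β : (𝔟 : Ideal (𝓞 K)), normTwist χ s (Ideal.span {(β : 𝓞 K)}) =
      Nat.card (𝓞 K)ˣ * normTwist χ s 𝔟 *
        ∑' 𝔞 : ClassGroup.mk0 ⁻¹' {C}, normTwist χ s (𝔞 : (Ideal (𝓞 K))⁰) := by
  have := finite_units_of_imaginaryQuadratic hdeg himag emb
  have := Fintype.ofFinite (𝓞 K)ˣ
  obtain ⟨e, he⟩ := exists_equiv_class_prod_units h𝔟
  have hsum := h.summable_normTwist_span hdeg himag hs
  have hsupp : Function.support (fun β : (𝔟 : Ideal (𝓞 K)) ↦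
      normTwist χ s (Ideal.span {(β : 𝓞 K)})) ⊆ {β | (β : 𝓞 K) ≠ 0} := by
    intro β hβ h0
    refine hβ ?_
    simp only [h0, Set.singleton_zero, Ideal.span_zero, ← Ideal.zero_eq_bot, map_zero]
  rw [← tsum_subtype_eq_of_support_subset hsupp]
  have hsum' : Summable fun β : {β : (𝔟 : Ideal (𝓞 K)) // (β : 𝓞 K) ≠ 0} ↦
      normTwist χ s (Ideal.span {(β : 𝓞 K)}) :=
    (hsum.comp_injective Subtype.val_injective).comp_injective Subtype.val_injective
  have h1 := e.tsum_eq fun β ↦ normTwist χ s (Ideal.span {(β : 𝓞 K)})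
  refine h1.symm.trans ?_
  rw [Summable.tsum_prod (by exact hsum'.comp_injective e.injective), ← tsum_mul_left]
  refine tsum_congr fun 𝔞 ↦ ?_
  simp only [he, tsum_fintype, Finset.sum_const, Finset.card_univ, map_mul, nsmul_eq_mul,
    Nat.card_eq_fintype_card]
  ring

theorem exists_differentiableOn_tsum_class (h : IsUnitaryHecke emb 𝔑 l χ) (h𝔑 : 𝔑 ≠ ⊥)
    (hdeg : Module.finrank ℚ K = 2) (himag : IsEmpty (K →+* ℝ)) (hl : l ≠ 0)
    (C : ClassGroup (𝓞 K)) :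
    ∃ Λ : ℂ → ℂ, DifferentiableOn ℂ Λ {s | 1 / 2 < s.re} ∧ ∀ s : ℂ, 1 < s.re →
      Λ s = ∑' 𝔞 : ClassGroup.mk0 ⁻¹' {C}, normTwist χ s (𝔞 : (Ideal (𝓞 K))⁰) := by
  by_cases hC : ∃ 𝔞 : (Ideal (𝓞 K))⁰, ClassGroup.mk0 𝔞 = C ∧ IsCoprime (𝔞 : Ideal (𝓞 K)) 𝔑
  · obtain ⟨𝔞, rfl, h𝔞⟩ := hC
    set 𝔟 : (Ideal (𝓞 K))⁰ := 𝔞 ^ (Fintype.card (ClassGroup (𝓞 K)) - 1)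
    have h𝔟 : ClassGroup.mk0 𝔞 * ClassGroup.mk0 𝔟 = 1 := by
      rw [map_pow, mul_pow_sub_one Fintype.card_ne_zero, pow_card_eq_one]
    have h𝔟c : IsCoprime (𝔟 : Ideal (𝓞 K)) 𝔑 := by
      simpa [𝔟] using h𝔞.pow_left
    have h𝔟0 : (𝔟 : Ideal (𝓞 K)) ≠ 0 := nonZeroDivisors.coe_ne_zero 𝔟
    have hχ0 (s : ℂ) : normTwist χ s 𝔟 ≠ 0 := by
      refine mul_ne_zero (norm_ne_zero_iff.mp (by rw [h.norm_eq_one _ h𝔟c]; exact one_ne_zero)) ?_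
      have hN : (Ideal.absNorm (𝔟 : Ideal (𝓞 K)) : ℂ) ≠ 0 := by
        exact_mod_cast mt Ideal.absNorm_eq_zero_iff.mp h𝔟0
      simp [Complex.cpow_eq_zero_iff, hN]
    have := finite_units_of_imaginaryQuadratic hdeg himag emb
    have hw : (Nat.card (𝓞 K)ˣ : ℂ) ≠ 0 := by exact_mod_cast Nat.card_pos.ne'
    obtain ⟨Λ, hΛ, hΛ'⟩ := h.exists_differentiableOn_tsum_ideal h𝔑 hdeg himag hl h𝔟0
    refine ⟨fun s ↦ Λ s / (Nat.card (𝓞 K)ˣ * normTwist χ s 𝔟), ?_, fun s hs ↦ ?_⟩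
    · exact hΛ.fun_div ((differentiable_normTwist χ _).const_mul _).differentiableOn
        fun s _ ↦ mul_ne_zero hw (hχ0 s)
    · rw [div_eq_iff (mul_ne_zero hw (hχ0 s)), hΛ' s hs,
        h.tsum_ideal_eq_card_units_mul hdeg himag h𝔟 hs, mul_comm]
  · push Not at hC
    refine ⟨0, differentiableOn_const 0, fun s _ ↦ ?_⟩
    have hzero (𝔞 : (ClassGroup.mk0 : (Ideal (𝓞 K))⁰ →* _) ⁻¹' {C}) :
        normTwist χ s (𝔞 : (Ideal (𝓞 K))⁰) = 0 := by
      rw [normTwist_apply, h.eq_zero _ (hC 𝔞 𝔞.2), zero_mul]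
    simp [hzero]

theorem exists_differentiableOn_tsum (h : IsUnitaryHecke emb 𝔑 l χ) (h𝔑 : 𝔑 ≠ ⊥)
    (hdeg : Module.finrank ℚ K = 2) (himag : IsEmpty (K →+* ℝ)) (hl : l ≠ 0) :
    ∃ Λ : ℂ → ℂ, DifferentiableOn ℂ Λ {s | 1 / 2 < s.re} ∧ ∀ s : ℂ, 1 < s.re →
      Λ s = ∑' 𝔞, normTwist χ s 𝔞 := by
  choose Λ hΛ hΛ' using h.exists_differentiableOn_tsum_class h𝔑 hdeg himag hl
  refine ⟨fun s ↦ ∑ C, Λ C s, DifferentiableOn.fun_sum fun C _ ↦ hΛ C, fun s hs ↦ ?_⟩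
  have hsum := (summable_norm_normTwist h.norm_le_one hs).of_norm
  have hsupp : Function.support (fun 𝔞 ↦ normTwist χ s 𝔞) ⊆ ((Ideal (𝓞 K))⁰ : Set _) := by
    intro 𝔞 h𝔞
    refine mem_nonZeroDivisors_of_ne_zero ?_
    rintro rfl
    exact h𝔞 (map_zero _)
  beta_reduce
  rw [← tsum_subtype_eq_of_support_subset hsupp, Finset.sum_congr rfl fun C _ ↦ hΛ' C s hs]
  have hsum' : Summable fun 𝔞 : (Ideal (𝓞 K))⁰ ↦ normTwist χ s 𝔞 :=
    hsum.comp_injective Subtype.val_injective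
  have := (hsum'.hasSum.tsum_fiberwise (ClassGroup.mk0 : (Ideal (𝓞 K))⁰ →* _)).tsum_eq
  rw [tsum_fintype] at this
  exact this

end IsUnitaryHecke

end ClassDecomposition

section Nonvanishing

open Filter Topology

theorem isCoprime_iff_not_dvd_of_prime {R : Type*} [CommRing R] [IsDedekindDomain R]
    {𝔭 𝔑 : Ideal R} (h𝔭 : Prime 𝔭) : IsCoprime 𝔭 𝔑 ↔ ¬ 𝔭 ∣ 𝔑 := by
  refine ⟨fun h hdvd ↦ h𝔭.not_isUnit (h.isUnit_of_dvd' dvd_rfl hdvd), fun h ↦ ?_⟩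
  have hmax : 𝔭.IsMaximal := (Ideal.isPrime_of_prime h𝔭).isMaximal h𝔭.ne_zero
  rw [Ideal.isCoprime_iff_sup_eq]
  by_contra htop
  refine h (Ideal.dvd_iff_le.mpr ?_)
  rw [hmax.eq_of_le htop le_sup_left]
  exact le_sup_right

variable {K : Type*} [Field K] [NumberField K] {emb : K →+* ℂ} {𝔑 : Ideal (𝓞 K)} {l : ℕ}
  {χ : Ideal (𝓞 K) →*₀ ℂ}

namespace IsUnitaryHecke

/-- The classical inequality comparing an `L`-series at `σ`, `σ + it` and `σ + 2it`. -/
theorem one_le_norm_tsum_normTwist (h : IsUnitaryHecke emb 𝔑 l χ) {σ : ℝ} (hσ : 1 < σ) (t : ℝ) :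
    1 ≤ (∑' 𝔞 : Ideal (𝓞 K), (Ideal.absNorm 𝔞 : ℝ) ^ (-σ)) ^ 3 *
      ‖∑' 𝔞, normTwist χ (σ + t * Complex.I) 𝔞‖ ^ 4 *
      ‖∑' 𝔞, normTwist (χ * χ) (σ + 2 * t * Complex.I) 𝔞‖ := by
  let ω : Ideal (𝓞 K) →*₀ ℂ :=
    Complex.ofRealHom.toMonoidWithZeroHom.comp
      ((normHom : ℂ →*₀ ℝ).comp χ)
  have hω (𝔞) : ω 𝔞 = (‖χ 𝔞‖ : ℂ) := rfl
  have hω1 (𝔞) : ‖ω 𝔞‖ ≤ 1 := by rw [hω, Complex.norm_real, norm_norm]; exact h.norm_le_one 𝔞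
  have hs0 := summable_norm_normTwist hω1 (s := σ) (by simpa using hσ)
  refine (one_le_norm_tsum_mul (normTwist ω σ) (normTwist χ (σ + t * Complex.I))
    (normTwist (χ * χ) (σ + 2 * t * Complex.I)) hs0
    (summable_norm_normTwist h.norm_le_one (by simpa using hσ))
    (summable_norm_normTwist h.mul_self.norm_le_one (by simpa using hσ)) fun 𝔭 h𝔭 ↦ ?_).trans ?_
  · simp only [normTwist_apply, hω]
    change ∃ (a : ℝ) (z : ℂ), _ ∧ _ ∧ _ ∧ _ ∧ _ ∧ χ 𝔭 * χ 𝔭 * _ = _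
    by_cases hc : IsCoprime 𝔭 𝔑
    · have h1 := h.norm_eq_one 𝔭 hc
      have hN0 : Ideal.absNorm 𝔭 ≠ 0 := mt Ideal.absNorm_eq_zero_iff.mp h𝔭.ne_zero
      have hN1 : Ideal.absNorm 𝔭 ≠ 1 := fun h' ↦ h𝔭.not_isUnit (by
        rw [Ideal.isUnit_iff]; exact Ideal.absNorm_eq_one_iff.mp h')
      have hN : (1 : ℝ) < Ideal.absNorm 𝔭 := by exact_mod_cast (by omega : 1 < Ideal.absNorm 𝔭)
      have hNC : (Ideal.absNorm 𝔭 : ℂ) ≠ 0 := by exact_mod_cast hN0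
      have hreal : (((Ideal.absNorm 𝔭 : ℝ) ^ (-σ) : ℝ) : ℂ)
          = (Ideal.absNorm 𝔭 : ℂ) ^ (-(σ : ℂ)) := by
        rw [Complex.ofReal_cpow (Nat.cast_nonneg _)]
        push_cast
        rfl
      refine ⟨(Ideal.absNorm 𝔭 : ℝ) ^ (-σ),
        χ 𝔭 * (Ideal.absNorm 𝔭 : ℂ) ^ (-(t * Complex.I)), by positivity,
        Real.rpow_lt_one_of_one_lt_of_neg hN (by linarith), ?_, ?_, ?_, ?_⟩
      · rw [norm_mul, h1, one_mul,
          Complex.norm_natCast_cpow_of_pos (Nat.pos_of_ne_zero hN0)]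
        simp
      · rw [h1, hreal, Complex.ofReal_one, one_mul]
      · rw [hreal, neg_add, Complex.cpow_add _ _ hNC]
        ring
      · rw [hreal, show -((σ : ℂ) + 2 * t * Complex.I)
          = -(σ : ℂ) + (-(t * Complex.I) + -(t * Complex.I)) by ring,
          Complex.cpow_add _ _ hNC, Complex.cpow_add _ _ hNC]
        ring
    · exact ⟨0, 1, le_rfl, one_pos, by simp, by simp [h.eq_zero 𝔭 hc], by simp [h.eq_zero 𝔭 hc],
        by simp [h.eq_zero 𝔭 hc]⟩
  · gcongr
    refine (norm_tsum_le_tsum_norm hs0).trans (hs0.tsum_le_tsum (fun 𝔞 ↦ ?_)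
      (hasSum_absNorm_rpow_dedekindZeta K hσ).summable)
    exact norm_normTwist_le hω1 σ 𝔞

theorem ne_zero_of_one_le_re (h : IsUnitaryHecke emb 𝔑 l χ) (h𝔑 : 𝔑 ≠ ⊥)
    (hdeg : Module.finrank ℚ K = 2) (himag : IsEmpty (K →+* ℝ)) (hl : l ≠ 0) {Λ : ℂ → ℂ}
    (hΛ : DifferentiableOn ℂ Λ {s | 1 / 2 < s.re})
    (hΛ' : ∀ s : ℂ, 1 < s.re → Λ s = ∑' 𝔞, normTwist χ s 𝔞) {s : ℂ} (hs : 1 ≤ s.re) :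
    Λ s ≠ 0 := by
  intro h0
  obtain ⟨Λ₂, hΛ₂, hΛ₂'⟩ := h.mul_self.exists_differentiableOn_tsum h𝔑 hdeg himag
    (mul_ne_zero two_ne_zero hl)
  have key {σ : ℝ} (hσ : 1 < σ) : 1 ≤ (∑' 𝔞 : Ideal (𝓞 K), (Ideal.absNorm 𝔞 : ℝ) ^ (-σ)) ^ 3 *
      ‖Λ (σ + s.im * Complex.I)‖ ^ 4 * ‖Λ₂ (σ + 2 * s.im * Complex.I)‖ := by
    rw [hΛ' _ (by simpa using hσ), hΛ₂' _ (by simpa using hσ)]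
    exact h.one_le_norm_tsum_normTwist hσ s.im
  rcases hs.lt_or_eq with hs | hs
  · have := key hs
    rw [Complex.re_add_im, h0] at this
    norm_num at this
  have hopen : IsOpen {s : ℂ | 1 / 2 < s.re} := isOpen_lt continuous_const Complex.continuous_re
  have hlim (w : ℂ) : Tendsto (fun x : ℝ ↦ w + x) (𝓝[>] 0) (𝓝 w) := by
    have : Continuous fun x : ℝ ↦ w + x := by fun_prop
    simpa using (this.tendsto 0).mono_left nhdsWithin_le_nhds
  obtain ⟨B, hB⟩ := exists_eventually_mul_tsum_absNorm_le K
  have hO := ((hΛ.differentiableAt (hopen.mem_nhds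
    (show (1 : ℝ) / 2 < s.re by linarith))).isBigO_sub).comp_tendsto (hlim s)
  obtain ⟨C, hC⟩ := hO.bound
  have hO₂ := (hΛ₂.differentiableAt (hopen.mem_nhds
    (show (1 : ℝ) / 2 < (1 + 2 * s.im * Complex.I : ℂ).re by simp; norm_num))).continuousAt.norm
  have hM := (hO₂.tendsto.comp (hlim _)).eventually_lt_const (lt_add_one _)
  set M := ‖Λ₂ (1 + 2 * s.im * Complex.I)‖ + 1
  have hsmall : Tendsto (fun x : ℝ ↦ B ^ 3 * C ^ 4 * M * x) (𝓝[>] 0) (𝓝 0) := by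
    have : Continuous fun x : ℝ ↦ B ^ 3 * C ^ 4 * M * x := by fun_prop
    simpa using (this.tendsto 0).mono_left nhdsWithin_le_nhds
  obtain ⟨x, hx0, hxB, hxC, hxM, hx1⟩ := (eventually_mem_nhdsWithin.and (hB.and (hC.and
    (hM.and (hsmall.eventually_lt_const one_pos))))).exists
  have hx : 0 < x := hx0
  have hk := key (show 1 < 1 + x by linarith)
  have e1 : ((1 + x : ℝ) : ℂ) + s.im * Complex.I = s + x := by
    conv_rhs => rw [← Complex.re_add_im s, ← hs]
    push_cast
    ring
  have e2 : ((1 + x : ℝ) : ℂ) + 2 * s.im * Complex.I = 1 + 2 * s.im * Complex.I + x := by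
    push_cast
    ring
  rw [e1, e2] at hk
  simp only [Function.comp_apply, h0, sub_zero, add_sub_cancel_left, Complex.norm_real,
    Real.norm_of_nonneg hx.le] at hxC hxM
  set Z := ∑' 𝔞 : Ideal (𝓞 K), (Ideal.absNorm 𝔞 : ℝ) ^ (-(1 + x))
  have hZ : 0 ≤ Z := tsum_nonneg fun _ ↦ by positivity
  refine (hk.trans_lt ?_).false
  calc Z ^ 3 * ‖Λ (s + x)‖ ^ 4 * ‖Λ₂ (1 + 2 * s.im * Complex.I + x)‖
      ≤ Z ^ 3 * (C * x) ^ 4 * M := by gcongr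
    _ = (x * Z) ^ 3 * (C ^ 4 * M * x) := by ring
    _ ≤ B ^ 3 * (C ^ 4 * M * x) := by gcongr
    _ = B ^ 3 * C ^ 4 * M * x := by ring
    _ < 1 := hx1

end IsUnitaryHecke

end Nonvanishing

/-- **Hecke's theorem for algebraic Hecke characters of an imaginary quadratic field.**
Let `K` be an imaginary quadratic field with a fixed complex embedding, `𝔑` a nonzero ideal
of `𝓞 K`, `l ≥ 1`, and `ψ` an algebraic Hecke character of `K` modulo `𝔑` of infinity type
`l` (a multiplicative nonvanishing function on ideals coprime to `𝔑` with
`ψ(αO_K) = α^l` for `α ≡ 1 (mod 𝔑)`).  Then the Euler product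
`∏_{𝔭 ∤ 𝔑} (1 - ψ(𝔭)·N(𝔭)^{-l/2}·N(𝔭)^{-s})⁻¹` extends to a holomorphic function on an
open neighborhood of `{Re(s) ≥ 1}` that does not vanish on `{Re(s) ≥ 1}`. -/
theorem stmt_9 (K : Type*) [Field K] [NumberField K]
    (hdeg : Module.finrank ℚ K = 2) (himag : IsEmpty (K →+* ℝ))
    (emb : K →+* ℂ)
    (𝔑 : Ideal (𝓞 K)) (h𝔑 : 𝔑 ≠ ⊥) (l : ℕ) (hl : 1 ≤ l)
    (ψ : Ideal (𝓞 K) → ℂ)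
    (hmul : ∀ 𝔞 𝔟 : Ideal (𝓞 K), IsCoprime 𝔞 𝔑 → IsCoprime 𝔟 𝔑 →
      ψ (𝔞 * 𝔟) = ψ 𝔞 * ψ 𝔟)
    (hne : ∀ 𝔞 : Ideal (𝓞 K), IsCoprime 𝔞 𝔑 → ψ 𝔞 ≠ 0)
    (halg : ∀ α : 𝓞 K, α - 1 ∈ 𝔑 → ψ (Ideal.span {α}) = emb (α : K) ^ l) :
    ∃ U : Set ℂ, IsOpen U ∧ {s : ℂ | 1 ≤ s.re} ⊆ U ∧
      ∃ Λ : ℂ → ℂ, AnalyticOnNhd ℂ Λ U ∧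
        (∀ s : ℂ, 1 < s.re →
          Λ s = ∏' 𝔭 : {𝔭 : Ideal (𝓞 K) // 𝔭.IsPrime ∧ 𝔭 ≠ ⊥ ∧ ¬ 𝔭 ∣ 𝔑},
            (1 - ψ 𝔭 * (Ideal.absNorm (𝔭 : Ideal (𝓞 K)) : ℂ) ^ (-(l : ℂ) / 2) *
              (Ideal.absNorm (𝔭 : Ideal (𝓞 K)) : ℂ) ^ (-s))⁻¹) ∧
        (∀ s : ℂ, 1 ≤ s.re → Λ s ≠ 0) := by
  have hl0 : l ≠ 0 := by omega
  obtain ⟨χ, hχ, hχψ⟩ := exists_isUnitaryHecke hdeg himag emb h𝔑 hl0 hmul hne halg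
  obtain ⟨Λ, hΛ, hΛ'⟩ := hχ.exists_differentiableOn_tsum h𝔑 hdeg himag hl0
  have hopen : IsOpen {s : ℂ | 1 / 2 < s.re} := isOpen_lt continuous_const Complex.continuous_re
  refine ⟨{s | 1 / 2 < s.re}, hopen, fun s (hs : 1 ≤ s.re) ↦ show 1 / 2 < s.re by linarith, Λ,
    hΛ.analyticOnNhd hopen, fun s hs ↦ ?_,
    fun s hs ↦ hχ.ne_zero_of_one_le_re h𝔑 hdeg himag hl0 hΛ hΛ' hs⟩
  have hprime {𝔭 : Ideal (𝓞 K)} (h : 𝔭.IsPrime ∧ 𝔭 ≠ ⊥ ∧ ¬ 𝔭 ∣ 𝔑) : Prime 𝔭 :=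
    Ideal.prime_of_isPrime h.2.1 h.1
  have hprod := hasProd_ideal_of_summable (normTwist χ s)
    (summable_norm_normTwist hχ.norm_le_one hs) (fun 𝔭 ↦ 𝔭.IsPrime ∧ 𝔭 ≠ ⊥ ∧ ¬ 𝔭 ∣ 𝔑)
    (fun _ ↦ hprime) fun 𝔭 h𝔭 h ↦ by
      rw [normTwist_apply, hχ.eq_zero 𝔭, zero_mul]
      rw [isCoprime_iff_not_dvd_of_prime h𝔭]
      exact fun h' ↦ h ⟨Ideal.isPrime_of_prime h𝔭, h𝔭.ne_zero, h'⟩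
  rw [hΛ' s hs, ← hprod.tprod_eq]
  refine tprod_congr fun 𝔭 ↦ ?_
  rw [normTwist_apply, hχψ _ ((isCoprime_iff_not_dvd_of_prime (hprime 𝔭.2)).mpr 𝔭.2.2.2)]
end
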